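/- arXiv:1902.04399 — 4 statements merged into one kernel-verified Lean document; each statement's English description precedes it below -/
import Mathlib

section
/- For any N ≥ 2, any p > 2, and any nonnegative measurable functions f_1, ..., f_N in L^p of a measure space (not all zero), one has ‖∑_{j=1}^N f_j‖_p^p ≤ [1 + (N-1) Γ_p(f_1,...,f_N)^{r(N,p)}]^{p-1} ∑_{j=1}^N ‖f_j‖_p^p, where r(N,p) = 2N/(2N + (p-2)(2N-1)). -/
open MeasureTheory Finset

theorem sum_Ioi_mul_eq {N : ℕ} (g : Fin N → ℝ) :
    ∑ i, ∑ j ∈ Finset.Ioi i, g i * g j = ((∑ i, g i) ^ 2 - ∑ i, g i ^ 2) / 2 := by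
  have h := Finset.sum_sum_Ioi_add_eq_sum_sum_off_diag (fun i j => g i * g j)
  have h1 : ∑ i, ∑ j ∈ Finset.Ioi i, (g j * g i + g i * g j)
      = 2 * ∑ i, ∑ j ∈ Finset.Ioi i, g i * g j := by
    simp only [Finset.mul_sum]
    exact Finset.sum_congr rfl fun i _ => Finset.sum_congr rfl fun j _ => by ring
  have h2 : ∑ i, ∑ j ∈ ({i}ᶜ : Finset (Fin N)), g j * g i
      = (∑ i, g i) ^ 2 - ∑ i, g i ^ 2 := by
    rw [sq, Finset.sum_mul_sum, ← Finset.sum_sub_distrib]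
    refine Finset.sum_congr rfl fun i _ => ?_
    rw [← Finset.sum_compl_add_sum {i} (fun j => g i * g j)]
    simp only [Finset.sum_singleton, mul_comm (g i)]
    ring
  linarith

/-- The function whose convexity drives the Jensen argument. -/
noncomputable def profile (p s S : ℝ) : ℝ := S * (S ^ (-(1 / (p - 1))) - 1) ^ s

theorem convexOn_profile {p s M : ℝ} (hp : 2 < p) (hs : 1 < s) (hM : 1 < M)
    (hsM : (p - 1 - s) * M ≤ p - 2) :
    ConvexOn ℝ (Set.Icc (M ^ (-(p - 1))) 1) (profile p s) := by
  set a := 1 / (p - 1) with ha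
  have ha0 : 0 < a := by rw [ha]; apply one_div_pos.2; linarith
  have hap : (p - 1) * a = 1 := by rw [ha]; field_simp [show p - 1 ≠ 0 by linarith]
  have hM0 : 0 < M ^ (-(p - 1)) := by positivity
  have hw0 : ∀ x ∈ Set.Ioo (M ^ (-(p - 1))) 1, 0 < x ^ (-a) - 1 := by
    intro x hx
    have := Real.one_lt_rpow_of_pos_of_lt_one_of_neg (hM0.trans hx.1) hx.2 (neg_lt_zero.2 ha0)
    linarith
  have hwM : ∀ x ∈ Set.Ioo (M ^ (-(p - 1))) 1, x ^ (-a) ≤ M := by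
    intro x hx
    have := Real.rpow_le_rpow_of_nonpos hM0 hx.1.le (neg_nonpos.2 ha0.le)
    rwa [← Real.rpow_mul (by linarith), show -(p - 1) * -a = 1 by linarith, Real.rpow_one] at this
  have hdw : ∀ x ∈ Set.Ioo (M ^ (-(p - 1))) 1,
      HasDerivAt (fun x : ℝ => x ^ (-a) - 1) (-a * x ^ (-a - 1)) x := fun x hx =>
    (Real.hasDerivAt_rpow_const (Or.inl (hM0.trans hx.1).ne')).sub_const 1
  refine convexOn_of_hasDerivWithinAt2_nonneg (convex_Icc _ _)
    (f' := fun x => (1 - a * s) * (x ^ (-a) - 1) ^ s - a * s * (x ^ (-a) - 1) ^ (s - 1))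
    (f'' := fun x => ((1 - a * s) * (s * (x ^ (-a) - 1) ^ (s - 1))
      - a * s * ((s - 1) * (x ^ (-a) - 1) ^ (s - 1 - 1))) * (-a * x ^ (-a - 1))) ?_ ?_ ?_ ?_
  · intro x hx
    have hx0 : 0 < x := hM0.trans_le hx.1
    apply ContinuousAt.continuousWithinAt
    unfold profile
    refine continuousAt_id.mul (ContinuousAt.rpow_const ?_ (Or.inr (by linarith)))
    exact (continuousAt_id.rpow_const (Or.inl hx0.ne')).sub continuousAt_const
  · rw [interior_Icc]
    intro x hx
    have hx0 : 0 < x := hM0.trans hx.1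
    apply HasDerivAt.hasDerivWithinAt
    have h := (hasDerivAt_id x).mul ((hdw x hx).rpow_const (p := s) (Or.inl (hw0 x hx).ne'))
    refine HasDerivAt.congr_deriv (f := profile p s) h ?_
    have e1 : x * x ^ (-a - 1) = x ^ (-a) := by
      rw [Real.rpow_sub_one hx0.ne']; field_simp
    have e2 : (x ^ (-a) - 1) ^ s = (x ^ (-a) - 1) ^ (s - 1) * (x ^ (-a) - 1) := by
      rw [Real.rpow_sub_one (hw0 x hx).ne', div_mul_cancel₀ _ (hw0 x hx).ne']
    rw [id, e2]
    linear_combination (- a * s * (x ^ (-a) - 1) ^ (s - 1)) * e1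
  · rw [interior_Icc]
    intro x hx
    apply HasDerivAt.hasDerivWithinAt
    have h1 := (hdw x hx).rpow_const (p := s) (Or.inl (hw0 x hx).ne')
    have h2 := (hdw x hx).rpow_const (p := s - 1) (Or.inl (hw0 x hx).ne')
    exact ((h1.const_mul (1 - a * s)).sub (h2.const_mul (a * s))).congr_deriv (by ring)
  · rw [interior_Icc]
    intro x hx
    have hx0 : 0 < x := hM0.trans hx.1
    have hw := hw0 x hx
    have e2 : (x ^ (-a) - 1) ^ (s - 1) = (x ^ (-a) - 1) ^ (s - 1 - 1) * (x ^ (-a) - 1) := by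
      rw [Real.rpow_sub_one hw.ne' (s - 1), div_mul_cancel₀ _ hw.ne']
    have hp1 : (p - 1) * ((1 - a * s) * (x ^ (-a) - 1) - a * (s - 1)) ≤ 0 := by
      have : (p - 1) * ((1 - a * s) * (x ^ (-a) - 1) - a * (s - 1))
          = (p - 1 - s) * x ^ (-a) - (p - 2) := by
        linear_combination (-s * (x ^ (-a) - 1) - (s - 1)) * hap
      rw [this]
      rcases le_total 0 (p - 1 - s) with h | h
      · nlinarith [mul_le_mul_of_nonneg_left (hwM x hx) h]
      · nlinarith [mul_nonneg (neg_nonneg.2 h) (Real.rpow_pos_of_pos hx0 (-a)).le]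
    have h3 : (1 - a * s) * (x ^ (-a) - 1) - a * (s - 1) ≤ 0 := by
      by_contra hc
      push Not at hc
      nlinarith [mul_pos (show 0 < p - 1 by linarith) hc]
    have : ((1 - a * s) * (s * (x ^ (-a) - 1) ^ (s - 1))
      - a * s * ((s - 1) * (x ^ (-a) - 1) ^ (s - 1 - 1))) * (-a * x ^ (-a - 1))
      = (s * (x ^ (-a) - 1) ^ (s - 1 - 1) * (a * x ^ (-a - 1))) *
        -((1 - a * s) * (x ^ (-a) - 1) - a * (s - 1)) := by
      rw [e2]; ring
    rw [this]
    exact mul_nonneg (by positivity) (neg_nonneg.2 h3)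

theorem ConvexOn.exists_add_mul_sub_le {D : Set ℝ} {φ : ℝ → ℝ} (hφ : ConvexOn ℝ D φ) {x₀ : ℝ}
    (hx₀ : x₀ ∈ interior D) : ∃ m : ℝ, ∀ x ∈ D, φ x₀ + m * (x - x₀) ≤ φ x := by
  refine ⟨derivWithin φ (Set.Ioi x₀) x₀, fun x hx => ?_⟩
  rcases lt_trichotomy x x₀ with h | rfl | h
  · have h1 := hφ.slope_le_leftDeriv_of_mem_interior hx hx₀ h
    have h2 := hφ.leftDeriv_le_rightDeriv_of_mem_interior hx₀
    have h3 := h1.trans h2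
    rw [slope_def_field, div_le_iff₀ (sub_pos.2 h)] at h3
    linarith
  · simp
  · have h1 := hφ.rightDeriv_le_slope_of_mem_interior hx₀ hx h
    rw [slope_def_field, le_div_iff₀ (sub_pos.2 h)] at h1
    linarith

/-- The scalar inequality behind the pointwise bound, a form of weighted AM-GM. -/
theorem profile_rpow_le {n p s : ℝ} (hn : 2 ≤ n) (hp : 2 < p)
    (hs : s = 1 + (p - 2) * (1 - 1 / (2 * n))) {u : ℝ} (hu0 : 0 < u) (hu1 : u ≤ 1) :
    1 / n * (n - 1) ^ (-s) * profile p s (u ^ (p - 1))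
      ≤ ((n * (n - 1) / 2)⁻¹ * ((1 - u) / 2)) ^ (p / 2) := by
  have hn0 : 0 < n := by linarith
  have hn1 : 0 < n - 1 := by linarith
  obtain ⟨x, hx⟩ : ∃ x, x = n * u := ⟨_, rfl⟩
  obtain ⟨y, hy⟩ : ∃ y, y = n * (1 - u) / (n - 1) := ⟨_, rfl⟩
  have hx0 : 0 < x := by rw [hx]; positivity
  have hy0 : 0 ≤ y := by
    rw [hy]; exact div_nonneg (mul_nonneg hn0.le (by linarith)) hn1.le
  have hs1 : 1 / (2 * n) ≤ 1 / 4 := by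
    apply one_div_le_one_div_of_le <;> linarith
  have hsp : p / 2 < s := by nlinarith
  have am := Real.geom_mean_le_arith_mean2_weighted (w₁ := 1 / n) (w₂ := 1 - 1 / n)
    (by positivity) (by rw [sub_nonneg, div_le_one hn0]; linarith) hx0.le hy0 (by ring)
  have am1 : 1 / n * x + (1 - 1 / n) * y = 1 := by rw [hx, hy]; field_simp; ring
  rw [am1] at am
  have am2 : x ^ (p - 1 - s) * y ^ (s - p / 2) ≤ 1 := by
    have := Real.rpow_le_one (by positivity) am (show 0 ≤ (p - 2) / 2 by linarith)
    rw [Real.mul_rpow (by positivity) (by positivity), ← Real.rpow_mul hx0.le,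
      ← Real.rpow_mul hy0] at this
    convert this using 3
    · rw [hs]; field_simp; ring
    · rw [hs]; field_simp; ring
  have hR : (n * (n - 1) / 2)⁻¹ * ((1 - u) / 2) = y / n ^ (2 : ℝ) := by
    rw [hy, Real.rpow_two]; field_simp
  have hP : (u ^ (p - 1)) ^ (-(1 / (p - 1))) - 1 = (n - 1) * (y / x) := by
    rw [← Real.rpow_mul hu0.le, show (p - 1) * -(1 / (p - 1)) = -1 by
      field_simp [show p - 1 ≠ 0 by linarith], Real.rpow_neg_one, hx, hy]
    field_simp
  have hux : u = x / n := by rw [hx]; field_simp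
  unfold profile
  rw [hP, hR, hux, Real.mul_rpow hn1.le (by positivity), Real.div_rpow hx0.le hn0.le,
    Real.div_rpow hy0 hx0.le, Real.div_rpow hy0 (by positivity), ← Real.rpow_mul hn0.le,
    show 2 * (p / 2) = p by ring, Real.rpow_neg hn1.le]
  have e1 : n ^ p = n ^ (p - 1) * n := by
    rw [Real.rpow_sub_one hn0.ne', div_mul_cancel₀ _ hn0.ne']
  have e2 : y ^ s = y ^ (p / 2) * y ^ (s - p / 2) := by
    rw [← Real.rpow_add_of_nonneg hy0 (by linarith) (by linarith)]; congr 1; ring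
  have e3 : x ^ (p - 1) = x ^ (p - 1 - s) * x ^ s := by
    rw [← Real.rpow_add hx0]; congr 1; ring
  rw [e1, e2, e3]
  have : 1 / n * ((n - 1) ^ s)⁻¹ * (x ^ (p - 1 - s) * x ^ s / n ^ (p - 1) *
      ((n - 1) ^ s * (y ^ (p / 2) * y ^ (s - p / 2) / x ^ s)))
      = y ^ (p / 2) / (n ^ (p - 1) * n) * (x ^ (p - 1 - s) * y ^ (s - p / 2)) := by
    field_simp
  rw [this]
  exact mul_le_of_le_one_right (by positivity) am2

theorem simplex_bounds {N : ℕ} (hN : 2 ≤ N) {p s : ℝ} (hp : 2 < p)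
    (hs : s = 1 + (p - 2) * (1 - 1 / (2 * (N : ℝ)))) {g : Fin N → ℝ} (hg : ∀ j, 0 ≤ g j)
    (hg1 : ∑ j, g j = 1) :
    (N : ℝ) ^ (-(p - 1)) ≤ ∑ j, g j ^ p ∧ ∑ j, g j ^ p ≤ 1 ∧
    1 / (N : ℝ) * ((N : ℝ) - 1) ^ (-s) * profile p s (∑ j, g j ^ p)
      ≤ (((N : ℝ) * ((N : ℝ) - 1) / 2)⁻¹ * ∑ i, ∑ j ∈ Finset.Ioi i, g i * g j) ^ (p / 2) := by
  have hn : (2 : ℝ) ≤ N := by exact_mod_cast hN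
  have hn0 : (0 : ℝ) < N := by linarith
  have hle : ∀ j, g j ≤ 1 := fun j =>
    hg1 ▸ Finset.single_le_sum (fun i _ => hg i) (Finset.mem_univ j)
  have hS1 : ∑ j, g j ^ p ≤ 1 := by
    rw [← hg1]
    refine Finset.sum_le_sum fun j _ => ?_
    simpa using Real.rpow_le_rpow_of_exponent_ge' (hg j) (hle j) zero_le_one (show 1 ≤ p by linarith)
  have hq : (∑ j, g j ^ 2) ^ (p - 1) ≤ ∑ j, g j ^ p := by
    have := Real.rpow_arith_mean_le_arith_mean_rpow Finset.univ g g (fun j _ => hg j) hg1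
      (fun j _ => hg j) (show 1 ≤ p - 1 by linarith)
    convert this using 2
    · exact Finset.sum_congr rfl fun j _ => sq (g j)
    · rename_i j _
      conv_lhs => rw [show p = 1 + (p - 1) by ring]
      rw [Real.rpow_add_of_nonneg (hg j) zero_le_one (by linarith), Real.rpow_one]
  have hqN : (N : ℝ)⁻¹ ≤ ∑ j, g j ^ 2 := by
    have := sq_sum_le_card_mul_sum_sq (s := Finset.univ) (f := g)
    rw [hg1, Finset.card_univ, Fintype.card_fin] at this
    rw [inv_le_iff_one_le_mul₀' hn0]
    linarith
  have hSN : (N : ℝ) ^ (-(p - 1)) ≤ ∑ j, g j ^ p := by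
    refine le_trans ?_ hq
    rw [Real.rpow_neg hn0.le, ← Real.inv_rpow hn0.le]
    exact Real.rpow_le_rpow (by positivity) hqN (by linarith)
  refine ⟨hSN, hS1, ?_⟩
  have hS0 : 0 < ∑ j, g j ^ p := (by positivity : (0 : ℝ) < (N : ℝ) ^ (-(p - 1))).trans_le hSN
  have hpa : 1 / (p - 1) * (p - 1) = 1 := by field_simp [show p - 1 ≠ 0 by linarith]
  have ha0 : 0 < 1 / (p - 1) := one_div_pos.2 (by linarith)
  have hu1 := Real.rpow_le_one hS0.le hS1 ha0.le
  have h := profile_rpow_le hn hp hs (Real.rpow_pos_of_pos hS0 (1 / (p - 1))) hu1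
  rw [← Real.rpow_mul hS0.le, hpa, Real.rpow_one] at h
  have hqu : ∑ j, g j ^ 2 ≤ (∑ j, g j ^ p) ^ (1 / (p - 1)) := by
    have := Real.rpow_le_rpow (by positivity) hq ha0.le
    rwa [← Real.rpow_mul (by positivity), mul_comm, hpa, Real.rpow_one] at this
  refine h.trans (Real.rpow_le_rpow ?_ ?_ (by linarith))
  · have : (0 : ℝ) < N - 1 := by linarith
    exact mul_nonneg (by positivity) (by linarith)
  · have : (0 : ℝ) < N - 1 := by linarith
    rw [sum_Ioi_mul_eq, hg1]
    gcongr
    linarith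

theorem affine_bound {N : ℕ} (hN : 2 ≤ N) {p s : ℝ} (hp : 2 < p)
    (hs : s = 1 + (p - 2) * (1 - 1 / (2 * (N : ℝ)))) {m k : ℝ}
    (hm : ∀ S, (N : ℝ) ^ (-(p - 1)) ≤ S → S ≤ 1 → m * S + k ≤ profile p s S)
    {g : Fin N → ℝ} (hg : ∀ j, 0 ≤ g j) :
    1 / (N : ℝ) * ((N : ℝ) - 1) ^ (-s) * (m * ∑ j, g j ^ p + k * (∑ j, g j) ^ p)
      ≤ (((N : ℝ) * ((N : ℝ) - 1) / 2)⁻¹ * ∑ i, ∑ j ∈ Finset.Ioi i, g i * g j) ^ (p / 2) := by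
  have hn : (2 : ℝ) ≤ N := by exact_mod_cast hN
  have hn1 : (0 : ℝ) < N - 1 := by linarith
  have hp0 : p ≠ 0 := by linarith
  rcases (Finset.sum_nonneg fun j _ => hg j : 0 ≤ ∑ j, g j).eq_or_lt with h0 | h0
  · have hz : ∀ j, g j = 0 := fun j =>
      (Finset.sum_eq_zero_iff_of_nonneg fun j _ => hg j).1 h0.symm j (Finset.mem_univ j)
    simp [hz, hp0, Real.zero_rpow]
  · set F := ∑ j, g j with hF
    have h1 : ∑ j, g j / F = 1 := by rw [← Finset.sum_div, div_self h0.ne']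
    obtain ⟨a1, a2, a3⟩ := simplex_bounds hN hp hs (fun j => div_nonneg (hg j) h0.le) h1
    have hS : (∑ j, (g j / F) ^ p) * F ^ p = ∑ j, g j ^ p := by
      rw [Finset.sum_mul]
      refine Finset.sum_congr rfl fun j _ => ?_
      rw [Real.div_rpow (hg j) h0.le, div_mul_cancel₀ _ (by positivity)]
    have hE : ∑ i, ∑ j ∈ Finset.Ioi i, g i * g j
        = F ^ 2 * ∑ i, ∑ j ∈ Finset.Ioi i, g i / F * (g j / F) := by
      simp only [Finset.mul_sum]
      refine Finset.sum_congr rfl fun i _ => Finset.sum_congr rfl fun j _ => ?_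
      field_simp
    have hFp : (F ^ 2) ^ (p / 2) = F ^ p := by
      rw [← Real.rpow_natCast, ← Real.rpow_mul h0.le]; congr 1; push_cast; ring
    have hE0 : 0 ≤ ∑ i, ∑ j ∈ Finset.Ioi i, g i / F * (g j / F) :=
      Finset.sum_nonneg fun i _ => Finset.sum_nonneg fun j _ =>
        mul_nonneg (div_nonneg (hg i) h0.le) (div_nonneg (hg j) h0.le)
    rw [hE, mul_left_comm, Real.mul_rpow (by positivity) (by positivity), hFp, ← hS]
    have hc : 0 ≤ 1 / (N : ℝ) * ((N : ℝ) - 1) ^ (-s) := by positivity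
    have h2 := (mul_le_mul_of_nonneg_left (hm _ a1 a2) hc).trans a3
    have h3 := mul_le_mul_of_nonneg_left h2 (Real.rpow_pos_of_pos h0 p).le
    refine le_trans (le_of_eq ?_) h3
    ring

theorem rpow_sum_le_and_ge {N : ℕ} (hN : 2 ≤ N) {p : ℝ} (hp : 2 < p)
    {g : Fin N → ℝ} (hg : ∀ j, 0 ≤ g j) :
    (N : ℝ) ^ (-(p - 1)) * (∑ j, g j) ^ p ≤ ∑ j, g j ^ p ∧ ∑ j, g j ^ p ≤ (∑ j, g j) ^ p := by
  rcases (Finset.sum_nonneg fun j _ => hg j : 0 ≤ ∑ j, g j).eq_or_lt with h0 | h0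
  · have hz : ∀ j, g j = 0 := fun j =>
      (Finset.sum_eq_zero_iff_of_nonneg fun j _ => hg j).1 h0.symm j (Finset.mem_univ j)
    simp [hz, Real.zero_rpow (show p ≠ 0 by linarith)]
  · set F := ∑ j, g j with hF
    have h1 : ∑ j, g j / F = 1 := by rw [← Finset.sum_div, div_self h0.ne']
    obtain ⟨a1, a2, -⟩ := simplex_bounds hN hp rfl (fun j => div_nonneg (hg j) h0.le) h1
    have hS : (∑ j, (g j / F) ^ p) * F ^ p = ∑ j, g j ^ p := by
      rw [Finset.sum_mul]
      refine Finset.sum_congr rfl fun j _ => ?_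
      rw [Real.div_rpow (hg j) h0.le, div_mul_cancel₀ _ (by positivity)]
    have hFp := (Real.rpow_pos_of_pos h0 p).le
    rw [← hS]
    exact ⟨mul_le_mul_of_nonneg_right a1 hFp, mul_le_of_le_one_left hFp a2⟩

theorem main_theorem_p_gt_two
    {α : Type*} [MeasurableSpace α] (μ : Measure α)
    (N : ℕ) (hN : 2 ≤ N) (p : ℝ) (hp : 2 < p)
    (f : Fin N → α → ℝ) (hm : ∀ j, Measurable (f j))
    (hnn : ∀ j x, 0 ≤ f j x)
    (hLp : ∀ j, Integrable (fun x => f j x ^ p) μ)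
    (hne : 0 < ∑ j, ∫ x, f j x ^ p ∂μ)
    (Γ r : ℝ)
    (hΓ : Γ = (∫ x, (((N : ℝ) * ((N : ℝ) - 1) / 2)⁻¹ *
        ∑ i, ∑ j ∈ Finset.Ioi i, f i x * f j x) ^ (p / 2) ∂μ) /
      ((1 / (N : ℝ)) * ∑ j, ∫ x, f j x ^ p ∂μ))
    (hr : r = 2 * (N : ℝ) / (2 * (N : ℝ) + (p - 2) * (2 * (N : ℝ) - 1))) :
    ∫ x, (∑ j, f j x) ^ p ∂μ
      ≤ (1 + ((N : ℝ) - 1) * Γ ^ r) ^ (p - 1) * ∑ j, ∫ x, f j x ^ p ∂μ := by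
  have hn : (2 : ℝ) ≤ N := by exact_mod_cast hN
  have hn0 : (0 : ℝ) < N := by linarith
  have hn1 : (0 : ℝ) < N - 1 := by linarith
  have hp1 : (0 : ℝ) < p - 1 := by linarith
  obtain ⟨s, hs⟩ : ∃ s : ℝ, s = 1 + (p - 2) * (1 - 1 / (2 * (N : ℝ))) := ⟨_, rfl⟩
  have hθ1 : 1 / (2 * (N : ℝ)) ≤ 1 / 4 := by
    apply one_div_le_one_div_of_le <;> linarith
  have hs1 : 1 < s := by nlinarith
  have hsN : (p - 1 - s) * (2 * (N : ℝ)) ≤ p - 2 := by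
    rw [hs]; apply le_of_eq; field_simp; ring
  have hrs : s * r = 1 := by
    have : 0 < 2 * (N : ℝ) + (p - 2) * (2 * (N : ℝ) - 1) := by
      have := mul_pos (show 0 < p - 2 by linarith) (show 0 < 2 * (N : ℝ) - 1 by linarith)
      linarith
    rw [hs, hr]; field_simp
  have hr0 : 0 < r := by
    by_contra h
    nlinarith
  have hFm : Measurable fun x => ∑ j, f j x := Finset.measurable_sum _ fun j _ => hm j
  have hbi : Integrable (fun x => ∑ j, f j x ^ p) μ := integrable_finsetSum _ fun j _ => hLp j
  have hF0 : ∀ x, 0 ≤ ∑ j, f j x := fun x => Finset.sum_nonneg fun j _ => hnn j x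
  have hbd := fun x => rpow_sum_le_and_ge hN hp fun j => hnn j x
  have hFi : Integrable (fun x => (∑ j, f j x) ^ p) μ := by
    refine (hbi.const_mul ((N : ℝ) ^ (p - 1))).mono' (hFm.pow_const p).aestronglyMeasurable
      (Filter.Eventually.of_forall fun x => ?_)
    rw [Real.norm_of_nonneg (Real.rpow_nonneg (hF0 x) p)]
    have := mul_le_mul_of_nonneg_left (hbd x).1 (show 0 ≤ (N : ℝ) ^ (p - 1) by positivity)
    rwa [← mul_assoc, ← Real.rpow_add hn0, add_neg_cancel, Real.rpow_zero, one_mul] at this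
  obtain ⟨e, he⟩ : ∃ e : α → ℝ, e = fun x => ((N : ℝ) * ((N : ℝ) - 1) / 2)⁻¹ *
    ∑ i, ∑ j ∈ Finset.Ioi i, f i x * f j x := ⟨_, rfl⟩
  have he0 : ∀ x, 0 ≤ e x := fun x => he ▸ mul_nonneg (by positivity)
    (Finset.sum_nonneg fun i _ => Finset.sum_nonneg fun j _ => mul_nonneg (hnn i x) (hnn j x))
  have hem : Measurable e := he ▸ Measurable.const_mul
    (Finset.measurable_sum _ fun i _ => Finset.measurable_sum _ fun j _ => (hm i).mul (hm j)) _
  have heF : ∀ x, e x ≤ (∑ j, f j x) ^ 2 := by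
    intro x
    rw [he]
    simp only [sum_Ioi_mul_eq]
    have h1 : ((N : ℝ) * ((N : ℝ) - 1) / 2)⁻¹ ≤ 1 := inv_le_one_of_one_le₀ (by nlinarith)
    have h2 : 0 ≤ ((∑ i, f i x) ^ 2 - ∑ i, f i x ^ 2) / 2 := by
      rw [← sum_Ioi_mul_eq]
      exact Finset.sum_nonneg fun i _ => Finset.sum_nonneg fun j _ => mul_nonneg (hnn i x) (hnn j x)
    refine (mul_le_of_le_one_left h2 h1).trans ?_
    have : 0 ≤ ∑ i, f i x ^ 2 := by positivity
    nlinarith [sq_nonneg (∑ i, f i x)]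
  have hDi : Integrable (fun x => e x ^ (p / 2)) μ := by
    refine hFi.mono' (hem.pow_const _).aestronglyMeasurable
      (Filter.Eventually.of_forall fun x => ?_)
    rw [Real.norm_of_nonneg (Real.rpow_nonneg (he0 x) _)]
    refine (Real.rpow_le_rpow (he0 x) (heF x) (by linarith)).trans (le_of_eq ?_)
    rw [← Real.rpow_natCast, ← Real.rpow_mul (hF0 x)]; congr 1; push_cast; ring
  rw [← integral_finsetSum _ fun j _ => hLp j] at hΓ hne ⊢
  obtain ⟨A, hA⟩ : ∃ A, A = ∫ x, (∑ j, f j x) ^ p ∂μ := ⟨_, rfl⟩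
  obtain ⟨B, hB⟩ : ∃ B, B = ∫ x, ∑ j, f j x ^ p ∂μ := ⟨_, rfl⟩
  obtain ⟨D, hD⟩ : ∃ D, D = ∫ x, e x ^ (p / 2) ∂μ := ⟨_, rfl⟩
  have hΓ' : Γ = D / (1 / (N : ℝ) * B) := by rw [hΓ, hD, hB, he]
  rw [← hB] at hne
  rw [← hA, ← hB]
  have hBA : B ≤ A := by
    rw [hA, hB]; exact integral_mono hbi hFi fun x => (hbd x).2
  have hAB : (N : ℝ) ^ (-(p - 1)) * A ≤ B := by
    rw [hA, hB, ← integral_const_mul]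
    exact integral_mono (hFi.const_mul _) hbi fun x => (hbd x).1
  have hA0 : 0 < A := hne.trans_le hBA
  have hD0 : 0 ≤ D := hD ▸ integral_nonneg fun x => Real.rpow_nonneg (he0 x) _
  have hΓ0 : 0 ≤ Γ := by rw [hΓ']; positivity
  rcases hBA.eq_or_lt with hEq | hlt
  · rw [← hEq]
    refine le_mul_of_one_le_left hne.le (Real.one_le_rpow ?_ hp1.le)
    have := mul_nonneg hn1.le (Real.rpow_nonneg hΓ0 r)
    linarith
  obtain ⟨S, hS⟩ : ∃ S, S = B / A := ⟨_, rfl⟩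
  have hS0 : 0 < S := by rw [hS]; positivity
  have hS1 : S < 1 := by rw [hS]; exact (div_lt_one hA0).2 hlt
  have hSN : (N : ℝ) ^ (-(p - 1)) ≤ S := by rw [hS]; exact (le_div_iff₀ hA0).2 hAB
  have h2N : (2 * (N : ℝ)) ^ (-(p - 1)) < (N : ℝ) ^ (-(p - 1)) :=
    Real.rpow_lt_rpow_of_neg hn0 (by linarith) (by linarith)
  have hBS : B = S * A := by rw [hS]; field_simp
  obtain ⟨m, hm'⟩ := (convexOn_profile hp hs1 (show 1 < 2 * (N : ℝ) by linarith)
    hsN).exists_add_mul_sub_le (x₀ := S) (by rw [interior_Icc]; exact ⟨h2N.trans_le hSN, hS1⟩)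
  have key : 1 / (N : ℝ) * ((N : ℝ) - 1) ^ (-s) * (profile p s S * A) ≤ D := by
    have h1 : ∀ x, 1 / (N : ℝ) * ((N : ℝ) - 1) ^ (-s) *
        (m * ∑ j, f j x ^ p + (profile p s S - m * S) * (∑ j, f j x) ^ p) ≤ e x ^ (p / 2) := by
      intro x
      rw [he]
      refine affine_bound hN hp hs (fun T hT hT1 => ?_) fun j => hnn j x
      have := hm' T ⟨h2N.le.trans hT, hT1⟩
      linarith
    have h2 := integral_mono (((hbi.const_mul m).add (hFi.const_mul _)).const_mul _) hDi h1
    rw [integral_const_mul, integral_add' (hbi.const_mul m) (hFi.const_mul _), integral_const_mul,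
      integral_const_mul, ← hA, ← hB, ← hD, hBS] at h2
    refine le_trans (le_of_eq ?_) h2
    ring
  obtain ⟨w, hw⟩ : ∃ w, w = S ^ (-(1 / (p - 1))) - 1 := ⟨_, rfl⟩
  have hw0 : 0 ≤ w := by
    have := Real.one_le_rpow_of_pos_of_le_one_of_nonpos hS0 hS1.le
      (neg_nonpos.2 (one_div_pos.2 hp1).le)
    linarith
  have hΓw : (w / (N - 1)) ^ s ≤ Γ := by
    rw [hΓ', le_div_iff₀ (by positivity)]
    refine le_trans (le_of_eq ?_) key
    rw [profile, ← hw, hBS, Real.div_rpow hw0 hn1.le, Real.rpow_neg hn1.le]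
    field_simp
  have hwr : w / (N - 1) ≤ Γ ^ r := by
    have := Real.rpow_le_rpow (by positivity) hΓw hr0.le
    rwa [← Real.rpow_mul (by positivity), hrs, Real.rpow_one] at this
  have hfin : S ^ (-(1 / (p - 1))) ≤ 1 + ((N : ℝ) - 1) * Γ ^ r := by
    rw [div_le_iff₀ hn1] at hwr
    linarith
  have hinv : S⁻¹ ≤ (1 + ((N : ℝ) - 1) * Γ ^ r) ^ (p - 1) := by
    have := Real.rpow_le_rpow (by positivity) hfin hp1.le
    rwa [← Real.rpow_mul hS0.le, show -(1 / (p - 1)) * (p - 1) = -1 by field_simp,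
      Real.rpow_neg_one] at this
  calc A = S⁻¹ * B := by rw [hBS]; field_simp
    _ ≤ _ := mul_le_mul_of_nonneg_right hinv hne.le
end

section
/- For any N ≥ 2, any p ∈ (1,2), and any nonnegative measurable functions f_1, ..., f_N in L^p of a measure space (not all zero), one has ‖∑_{j=1}^N f_j‖_p^p ≥ [1 + (N-1) Γ_p(f_1,...,f_N)^{r(N,p)}]^{p-1} ∑_{j=1}^N ‖f_j‖_p^p, where r(N,p) = 2N/(2N + (p-2)(2N-1)). -/
open MeasureTheory Finset

theorem sum_sq_eq_sum_sq_add_two_mul_sum_Ioi {ι : Type*} [Fintype ι] [LinearOrder ι]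
    [LocallyFiniteOrderTop ι] (x : ι → ℝ) :
    (∑ j, x j) ^ 2 = ∑ j, x j ^ 2 + 2 * ∑ i, ∑ j ∈ Finset.Ioi i, x i * x j := by
  have hIoi : ∑ i, ∑ j ∈ Finset.Ioi i, x i * x j
      = ∑ i, ∑ j, if i < j then x i * x j else 0 := by
    refine Finset.sum_congr rfl fun i _ => ?_
    rw [← Finset.sum_filter]
    congr 1
    ext j
    simp
  have hswap : ∑ i, ∑ j, (if i < j then x i * x j else 0)
      = ∑ i, ∑ j, if j < i then x i * x j else 0 := by
    rw [Finset.sum_comm]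
    simp only [mul_comm]
  have hdiag : ∑ j, x j ^ 2 = ∑ i, ∑ j, if i = j then x i * x j else 0 := by
    simp [sq]
  rw [two_mul, hIoi]
  nth_rewrite 2 [hswap]
  rw [hdiag, ← Finset.sum_add_distrib, ← Finset.sum_add_distrib, sq, Finset.sum_mul_sum]
  refine Finset.sum_congr rfl fun i _ => ?_
  rw [← Finset.sum_add_distrib, ← Finset.sum_add_distrib]
  refine Finset.sum_congr rfl fun j _ => ?_
  rcases lt_trichotomy i j with h | h | h
  · simp [h, h.ne, h.not_gt]
  · simp [h]
  · simp [h, h.ne', h.not_gt]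

theorem tangent_le_of_monotoneOn_deriv {f f' : ℝ → ℝ} {s : Set ℝ} (hs : s.OrdConnected)
    (hf : ∀ x ∈ s, HasDerivAt f (f' x) x) (hmono : MonotoneOn f' s) {x y : ℝ}
    (hx : x ∈ s) (hy : y ∈ s) : f x + f' x * (y - x) ≤ f y := by
  rcases lt_trichotomy x y with h | rfl | h
  · have hsub := hs.out hx hy
    obtain ⟨c, hc, he⟩ := exists_hasDerivAt_eq_slope f f' h
      (fun t ht => (hf t (hsub ht)).continuousAt.continuousWithinAt)
      (fun t ht => hf t (hsub (Set.Ioo_subset_Icc_self ht)))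
    have hle := hmono hx (hsub (Set.Ioo_subset_Icc_self hc)) hc.1.le
    rw [he, le_div_iff₀ (sub_pos.2 h)] at hle
    linarith
  · simp
  · have hsub := hs.out hy hx
    obtain ⟨c, hc, he⟩ := exists_hasDerivAt_eq_slope f f' h
      (fun t ht => (hf t (hsub ht)).continuousAt.continuousWithinAt)
      (fun t ht => hf t (hsub (Set.Ioo_subset_Icc_self ht)))
    have hle := hmono (hsub (Set.Ioo_subset_Icc_self hc)) hx hc.2.le
    rw [he, div_le_iff₀ (sub_pos.2 h)] at hle
    linarith

theorem pow_div_one_add_mul_pow_le (N : ℕ) (hN : 1 ≤ N) {v w : ℝ} (hv : 0 ≤ v) (hvw : v ≤ w)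
    (hw : w ≤ 1) :
    v ^ (2 * N - 1) / (1 + ((N : ℝ) - 1) * v ^ (2 * N))
      ≤ w ^ (2 * N - 1) / (1 + ((N : ℝ) - 1) * w ^ (2 * N)) := by
  have hN1 : (0 : ℝ) ≤ (N : ℝ) - 1 := by
    have : (1 : ℝ) ≤ N := by exact_mod_cast hN
    linarith
  have hw0 : 0 ≤ w := hv.trans hvw
  rw [div_le_div_iff₀ (by positivity) (by positivity)]
  obtain ⟨k, rfl⟩ : ∃ k, N = k + 1 := ⟨N - 1, by omega⟩
  have e1 : 2 * (k + 1) - 1 = 2 * k + 1 := by omega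
  have e2 : 2 * (k + 1) = (2 * k + 1) + 1 := by ring
  rw [e1, e2]
  have hsum : (k : ℝ) * (v ^ (2 * k + 1) * w ^ (2 * k + 1))
      ≤ ∑ i ∈ Finset.range (2 * k + 1), w ^ i * v ^ (2 * k + 1 - 1 - i) := by
    have hterm : ∀ i ∈ Finset.range (2 * k + 1),
        v ^ (2 * k + 1) * w ^ (2 * k + 1) ≤ w ^ i * v ^ (2 * k + 1 - 1 - i) := by
      intro i hi
      rw [Finset.mem_range] at hi
      rw [mul_comm]
      exact mul_le_mul (pow_le_pow_of_le_one hw0 hw hi.le)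
        (pow_le_pow_of_le_one hv (hvw.trans hw) (by omega)) (by positivity) (by positivity)
    have hcard := Finset.card_nsmul_le_sum _ _ _ hterm
    rw [Finset.card_range, nsmul_eq_mul] at hcard
    have hpos : 0 ≤ v ^ (2 * k + 1) * w ^ (2 * k + 1) := by positivity
    refine le_trans ?_ hcard
    push_cast
    nlinarith [(Nat.cast_nonneg k : (0 : ℝ) ≤ k)]
  have hgeom := (Commute.all w v).geom_sum₂_mul (2 * k + 1)
  have hmul := mul_le_mul_of_nonneg_right hsum (sub_nonneg.2 hvw)
  rw [hgeom] at hmul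
  push_cast
  rw [pow_succ v (2 * k + 1), pow_succ w (2 * k + 1)]
  nlinarith [hmul]

theorem rpow_exponent_denom_pos (N : ℕ) (hN : 2 ≤ N) {p : ℝ} (hp1 : 1 < p) :
    0 < 2 * (N : ℝ) + (p - 2) * (2 * (N : ℝ) - 1) := by
  have : (2 : ℝ) ≤ N := by exact_mod_cast hN
  nlinarith

theorem one_le_rpow_exponent (N : ℕ) (hN : 2 ≤ N) {p r : ℝ} (hp1 : 1 < p) (hp2 : p < 2)
    (hr : r = 2 * (N : ℝ) / (2 * (N : ℝ) + (p - 2) * (2 * (N : ℝ) - 1))) : 1 ≤ r := by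
  have : (2 : ℝ) ≤ N := by exact_mod_cast hN
  rw [hr, le_div_iff₀ (rpow_exponent_denom_pos N hN hp1)]
  nlinarith

theorem exists_supporting_slope (N : ℕ) (hN : 2 ≤ N) {p r : ℝ} (hp1 : 1 < p) (hp2 : p < 2)
    (hr : r = 2 * (N : ℝ) / (2 * (N : ℝ) + (p - 2) * (2 * (N : ℝ) - 1)))
    {g : ℝ} (hg : g ∈ Set.Icc (0 : ℝ) 1) :
    ∃ k : ℝ, ∀ t ∈ Set.Icc (0 : ℝ) 1,
      (1 + ((N : ℝ) - 1) * g ^ r) ^ (p - 1) + k * (t - g)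
        ≤ (1 + ((N : ℝ) - 1) * t ^ r) ^ (p - 1) := by
  have hN2 : (2 : ℝ) ≤ N := by exact_mod_cast hN
  have hr1 := one_le_rpow_exponent N hN hp1 hp2 hr
  have hD := rpow_exponent_denom_pos N hN hp1
  set D := 2 * (N : ℝ) + (p - 2) * (2 * (N : ℝ) - 1) with hDdef
  have hc : (0 : ℝ) < (N : ℝ) - 1 := by linarith
  have hbase : ∀ t ∈ Set.Icc (0 : ℝ) 1, 0 < 1 + ((N : ℝ) - 1) * t ^ r := fun t ht => by
    have := Real.rpow_nonneg ht.1 r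
    positivity
  let F : ℝ → ℝ := fun t => ((N : ℝ) - 1) * (r * t ^ (r - 1)) * (p - 1)
    * (1 + ((N : ℝ) - 1) * t ^ r) ^ (p - 1 - 1)
  have hderiv : ∀ t ∈ Set.Icc (0 : ℝ) 1,
      HasDerivAt (fun t : ℝ => (1 + ((N : ℝ) - 1) * t ^ r) ^ (p - 1)) (F t) t := fun t ht =>
    (((Real.hasDerivAt_rpow_const (Or.inr hr1)).const_mul _).const_add 1).rpow_const
      (Or.inl (hbase t ht).ne')
  have hF : ∀ t ∈ Set.Icc (0 : ℝ) 1, F t = ((N : ℝ) - 1) * r * (p - 1)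
      * ((t ^ (1 / D)) ^ (2 * N - 1)
        / (1 + ((N : ℝ) - 1) * (t ^ (1 / D)) ^ (2 * N))) ^ (2 - p) := by
    intro t ht
    have hpow : (t ^ (1 / D)) ^ (2 * N) = t ^ r := by
      rw [← Real.rpow_mul_natCast ht.1, hr]
      congr 1
      push_cast
      ring
    have hpow' : ((t ^ (1 / D)) ^ (2 * N - 1)) ^ (2 - p) = t ^ (r - 1) := by
      rw [← Real.rpow_mul_natCast ht.1, ← Real.rpow_mul ht.1, hr]
      congr 1
      rw [Nat.cast_sub (by omega)]
      push_cast
      field_simp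
      rw [hDdef]
      ring
    rw [hpow, Real.div_rpow (pow_nonneg (Real.rpow_nonneg ht.1 _) _) (hbase t ht).le, hpow',
      div_eq_mul_inv, ← Real.rpow_neg (hbase t ht).le]
    simp only [F]
    rw [show p - 1 - 1 = -(2 - p) by ring]
    ring
  have hmono : MonotoneOn F (Set.Icc 0 1) := by
    intro s hs t ht hst
    rw [hF s hs, hF t ht]
    have hD' : 0 ≤ 1 / D := by positivity
    have hs0 := Real.rpow_nonneg hs.1 (1 / D)
    refine mul_le_mul_of_nonneg_left (Real.rpow_le_rpow (by positivity)
      (pow_div_one_add_mul_pow_le N (by omega) hs0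
        (Real.rpow_le_rpow hs.1 hst hD') (Real.rpow_le_one ht.1 ht.2 hD')) (by linarith)) ?_
    have : 0 ≤ p - 1 := by linarith
    positivity
  exact ⟨F g, fun t ht => tangent_le_of_monotoneOn_deriv Set.ordConnected_Icc hderiv hmono hg ht⟩

theorem rpow_mul_rpow_le_div (N : ℕ) (hN : 2 ≤ N) {p r : ℝ} (hp1 : 1 < p) (hp2 : p < 2)
    (hr : r = 2 * (N : ℝ) / (2 * (N : ℝ) + (p - 2) * (2 * (N : ℝ) - 1)))
    {b u : ℝ} (hu : 0 ≤ u) (hb0 : 0 < b) (hb : b + ((N : ℝ) - 1) * u = N) :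
    (u ^ (p / 2) / b ^ (p - 1)) ^ r ≤ u / b := by
  have hD := rpow_exponent_denom_pos N hN hp1
  set D := 2 * (N : ℝ) + (p - 2) * (2 * (N : ℝ) - 1) with hDdef
  set κ := (2 - p) / D with hκ
  have hκ0 : 0 ≤ κ := div_nonneg (by linarith) hD.le
  have hN2 : (2 : ℝ) ≤ N := by exact_mod_cast hN
  have hbern : u ^ (N - 1) * b ≤ 1 := by
    have hweights : ((N : ℝ) - 1) / N + 1 / N = 1 := by field_simp; ring
    have ham := Real.geom_mean_le_arith_mean2_weighted (div_nonneg (by linarith) (by linarith))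
      (by positivity) hu hb0.le hweights
    have hmean : ((N : ℝ) - 1) / N * u + 1 / N * b = 1 := by
      field_simp
      linarith
    rw [hmean] at ham
    have hpow := pow_le_one₀ (n := N) (by positivity) ham
    rw [mul_pow, ← Real.rpow_mul_natCast hu, ← Real.rpow_mul_natCast hb0.le,
      div_mul_cancel₀ _ (by positivity), div_mul_cancel₀ _ (by positivity), Real.rpow_one,
      show (N : ℝ) - 1 = ((N - 1 : ℕ) : ℝ) by rw [Nat.cast_sub (by omega)]; simp,
      Real.rpow_natCast] at hpow
    exact hpow
  have hub : (u ^ (p / 2)) ^ r = u * (u ^ (N - 1)) ^ κ := by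
    have e : p / 2 * r = 1 + ((N - 1 : ℕ) : ℝ) * κ := by
      rw [Nat.cast_sub (by omega), hr, hκ]
      push_cast
      field_simp
      rw [hDdef]
      ring
    rw [← Real.rpow_mul hu, ← Real.rpow_natCast_mul hu, e,
      Real.rpow_add_of_nonneg hu zero_le_one (by positivity), Real.rpow_one]
  have hbb : (b ^ (p - 1)) ^ r = b / b ^ κ := by
    have e : (p - 1) * r = 1 - κ := by
      rw [hr, hκ]
      field_simp
      rw [hDdef]
      ring
    rw [← Real.rpow_mul hb0.le, e, Real.rpow_sub hb0, Real.rpow_one]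
  rw [Real.div_rpow (by positivity) (by positivity), hub, hbb]
  have hone : (u ^ (N - 1)) ^ κ * b ^ κ ≤ 1 := by
    rw [← Real.mul_rpow (by positivity) hb0.le]
    exact Real.rpow_le_one (by positivity) hbern hκ0
  have hbk : 0 < b ^ κ := by positivity
  calc u * (u ^ (N - 1)) ^ κ / (b / b ^ κ) = u / b * ((u ^ (N - 1)) ^ κ * b ^ κ) := by
        field_simp
    _ ≤ u / b * 1 := mul_le_mul_of_nonneg_left hone (by positivity)
    _ = u / b := mul_one _

theorem sum_rpow_div_sum_le {ι : Type*} [Fintype ι] {p : ℝ} (hp1 : 1 < p)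
    (hp2 : p < 2) {x : ι → ℝ} (hx : ∀ j, 0 ≤ x j) (hS : 0 < ∑ j, x j) :
    (∑ j, x j ^ p) / ∑ j, x j ≤ ((∑ j, x j ^ 2) / ∑ j, x j) ^ (p - 1) := by
  have h := (Real.concaveOn_rpow (p := p - 1) (by linarith) (by linarith)).le_map_sum
    (t := Finset.univ) (w := fun j => x j / ∑ i, x i) (p := x)
    (fun j _ => div_nonneg (hx j) hS.le)
    (by rw [← Finset.sum_div, div_self hS.ne']) (fun j _ => hx j)
  simp only [smul_eq_mul, div_mul_eq_mul_div, ← Finset.sum_div] at h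
  have e : ∀ j, x j * x j ^ (p - 1) = x j ^ p := fun j => by
    nth_rewrite 1 [← Real.rpow_one (x j)]
    rw [← Real.rpow_add_of_nonneg (hx j) zero_le_one (by linarith)]
    congr 1
    ring
  simpa only [e, ← sq] using h

theorem rpow_sum_le_mul_sum_rpow (N : ℕ) {p : ℝ} (hp1 : 1 < p) {x : Fin N → ℝ}
    (hx : ∀ j, 0 ≤ x j) : (∑ j, x j) ^ p ≤ (N : ℝ) ^ (p - 1) * ∑ j, x j ^ p := by
  have h := Real.rpow_sum_le_const_mul_sum_rpow_of_nonneg Finset.univ hp1.le (fun j _ => hx j)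
  rwa [Finset.card_univ, Fintype.card_fin] at h

theorem sum_rpow_pos (N : ℕ) {p : ℝ} (hp1 : 1 < p) {x : Fin N → ℝ}
    (hx : ∀ j, 0 ≤ x j) (hS : 0 < ∑ j, x j) : 0 < ∑ j, x j ^ p :=
  pos_of_mul_pos_right ((Real.rpow_pos_of_pos hS p).trans_le (rpow_sum_le_mul_sum_rpow N hp1 hx))
    (by positivity)

theorem pairMean_nonneg (N : ℕ) (hN : 2 ≤ N) {x : Fin N → ℝ} (hx : ∀ j, 0 ≤ x j) :
    0 ≤ ((N : ℝ) * ((N : ℝ) - 1) / 2)⁻¹ * ∑ i, ∑ j ∈ Finset.Ioi i, x i * x j := by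
  have hN2 : (2 : ℝ) ≤ N := by exact_mod_cast hN
  have hc : (0 : ℝ) ≤ (N : ℝ) - 1 := by linarith
  exact mul_nonneg (by positivity)
    (Finset.sum_nonneg fun i _ => Finset.sum_nonneg fun j _ => mul_nonneg (hx i) (hx j))

theorem pairMean_eq (N : ℕ) (hN : 2 ≤ N) (x : Fin N → ℝ) :
    ((N : ℝ) * ((N : ℝ) - 1) / 2)⁻¹ * ∑ i, ∑ j ∈ Finset.Ioi i, x i * x j
      = ((∑ j, x j) ^ 2 - ∑ j, x j ^ 2) / (N * ((N : ℝ) - 1)) := by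
  have hN2 : (2 : ℝ) ≤ N := by exact_mod_cast hN
  have hc : (0 : ℝ) < (N : ℝ) - 1 := by linarith
  rw [sum_sq_eq_sum_sq_add_two_mul_sum_Ioi]
  field_simp
  ring

theorem pairMean_rpow_le (N : ℕ) (hN : 2 ≤ N) {p : ℝ} (hp1 : 1 < p)
    {x : Fin N → ℝ} (hx : ∀ j, 0 ≤ x j) :
    (((N : ℝ) * ((N : ℝ) - 1) / 2)⁻¹ * ∑ i, ∑ j ∈ Finset.Ioi i, x i * x j) ^ (p / 2)
      ≤ (1 / (N : ℝ)) * ∑ j, x j ^ p := by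
  have hN2 : (2 : ℝ) ≤ N := by exact_mod_cast hN
  have hc : (0 : ℝ) < (N : ℝ) - 1 := by linarith
  have hS : 0 ≤ ∑ j, x j := Finset.sum_nonneg fun j _ => hx j
  have hle : ((N : ℝ) * ((N : ℝ) - 1) / 2)⁻¹ * ∑ i, ∑ j ∈ Finset.Ioi i, x i * x j
      ≤ ((∑ j, x j) / N) ^ 2 := by
    have hcs := sq_sum_le_card_mul_sum_sq (s := Finset.univ) (f := x)
    rw [Finset.card_univ, Fintype.card_fin] at hcs
    rw [pairMean_eq N hN, div_pow, div_le_div_iff₀ (by positivity) (by positivity)]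
    nlinarith [mul_le_mul_of_nonneg_left hcs (by linarith : (0 : ℝ) ≤ N)]
  have hpow := rpow_sum_le_mul_sum_rpow N hp1 hx
  calc _ ≤ (((∑ j, x j) / N) ^ 2) ^ (p / 2) :=
        Real.rpow_le_rpow (pairMean_nonneg N hN hx) hle (by linarith)
    _ = ((∑ j, x j) ^ p) / (N : ℝ) ^ p := by
        rw [← Real.rpow_natCast_mul (by positivity), ← Real.div_rpow hS (by positivity)]
        congr 1
        push_cast
        ring
    _ ≤ ((N : ℝ) ^ (p - 1) * ∑ j, x j ^ p) / (N : ℝ) ^ p := by gcongr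
    _ = _ := by
        rw [Real.rpow_sub (by positivity), Real.rpow_one]
        field_simp

theorem mul_sum_rpow_le_rpow_sum (N : ℕ) (hN : 2 ≤ N) {p r : ℝ} (hp1 : 1 < p) (hp2 : p < 2)
    (hr : r = 2 * (N : ℝ) / (2 * (N : ℝ) + (p - 2) * (2 * (N : ℝ) - 1)))
    {x : Fin N → ℝ} (hx : ∀ j, 0 ≤ x j) (hS : 0 < ∑ j, x j) :
    (1 + ((N : ℝ) - 1) *
      ((((N : ℝ) * ((N : ℝ) - 1) / 2)⁻¹ * ∑ i, ∑ j ∈ Finset.Ioi i, x i * x j) ^ (p / 2)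
        / ((1 / (N : ℝ)) * ∑ j, x j ^ p)) ^ r) ^ (p - 1) * ∑ j, x j ^ p
      ≤ (∑ j, x j) ^ p := by
  have hN2 : (2 : ℝ) ≤ N := by exact_mod_cast hN
  have hc : (0 : ℝ) < (N : ℝ) - 1 := by linarith
  have hr1 := one_le_rpow_exponent N hN hp1 hp2 hr
  have he0 := pairMean_nonneg N hN hx
  have heq := pairMean_eq N hN x
  have hH := sum_rpow_div_sum_le hp1 hp2 hx hS
  have hP := sum_rpow_pos N hp1 hx hS
  have hQ : 0 ≤ ∑ j, x j ^ 2 := Finset.sum_nonneg fun j _ => sq_nonneg _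
  set e := ((N : ℝ) * ((N : ℝ) - 1) / 2)⁻¹ * ∑ i, ∑ j ∈ Finset.Ioi i, x i * x j
  set S := ∑ j, x j
  set P := ∑ j, x j ^ p
  set Q := ∑ j, x j ^ 2
  set a := (P / S) ^ (p - 1)⁻¹ with ha
  set b := N * a / S with hbdef
  set u := (N - b) / ((N : ℝ) - 1) with hu
  have hp0 : 0 < p - 1 := by linarith
  have ha0 : 0 < a := by positivity
  have hb0 : 0 < b := by positivity
  have haP : a ^ (p - 1) = P / S := Real.rpow_inv_rpow (by positivity) hp0.ne'
  have haQ : a ≤ Q / S := by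
    rw [← Real.rpow_le_rpow_iff ha0.le (by positivity) hp0, haP]
    exact hH
  have hbu : b + ((N : ℝ) - 1) * u = N := by
    rw [hu]
    field_simp
    ring
  have heu : e ≤ (S / N) ^ 2 * u := by
    have : (S / N) ^ 2 * u = (S ^ 2 - a * S) / (N * ((N : ℝ) - 1)) := by
      rw [hu, hbdef]
      field_simp
    rw [heq, this]
    rw [le_div_iff₀ hS] at haQ
    gcongr
  have hu0 : 0 ≤ u := by
    have := he0.trans heu
    exact nonneg_of_mul_nonneg_right this (by positivity)
  have hSp : S ^ p = S ^ (p - 1) * S := by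
    rw [← Real.rpow_add_one hS.ne']
    congr 1
    ring
  have hNp : (N : ℝ) ^ p = (N : ℝ) ^ (p - 1) * N := by
    rw [← Real.rpow_add_one (by positivity)]
    congr 1
    ring
  have hbP : b ^ (p - 1) = (N : ℝ) ^ (p - 1) * P / S ^ p := by
    rw [hbdef, Real.div_rpow (by positivity) hS.le, Real.mul_rpow (by positivity) ha0.le, haP, hSp]
    field_simp
  have hγ : e ^ (p / 2) / ((1 / (N : ℝ)) * P) ≤ u ^ (p / 2) / b ^ (p - 1) := by
    have h1 : e ^ (p / 2) ≤ S ^ p / N ^ p * u ^ (p / 2) := by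
      refine (Real.rpow_le_rpow he0 heu (by linarith)).trans_eq ?_
      rw [Real.mul_rpow (by positivity) hu0, ← Real.rpow_natCast_mul (by positivity),
        ← Real.div_rpow hS.le (by positivity)]
      congr 2
      push_cast
      ring
    calc _ ≤ (S ^ p / N ^ p * u ^ (p / 2)) / ((1 / (N : ℝ)) * P) := by gcongr
      _ = _ := by
        rw [hbP, hNp]
        field_simp
  have hγr : (e ^ (p / 2) / ((1 / (N : ℝ)) * P)) ^ r ≤ u / b :=
    (Real.rpow_le_rpow (by positivity) hγ (by linarith)).trans
      (rpow_mul_rpow_le_div N hN hp1 hp2 hr hu0 hb0 hbu)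
  calc _ ≤ (1 + ((N : ℝ) - 1) * (u / b)) ^ (p - 1) * P := by gcongr
    _ = (N / b) ^ (p - 1) * P := by
        congr 2
        rw [eq_div_iff hb0.ne', add_mul, one_mul, mul_assoc, div_mul_cancel₀ _ hb0.ne', hbu]
    _ = S ^ p := by
        rw [Real.div_rpow (by positivity) hb0.le, hbP]
        field_simp

theorem main_theorem_p_lt_two
    {α : Type*} [MeasurableSpace α] (μ : Measure α)
    (N : ℕ) (hN : 2 ≤ N) (p : ℝ) (hp1 : 1 < p) (hp2 : p < 2)
    (f : Fin N → α → ℝ) (hm : ∀ j, Measurable (f j))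
    (hnn : ∀ j x, 0 ≤ f j x)
    (hLp : ∀ j, Integrable (fun x => f j x ^ p) μ)
    (hne : 0 < ∑ j, ∫ x, f j x ^ p ∂μ)
    (Γ r : ℝ)
    (hΓ : Γ = (∫ x, (((N : ℝ) * ((N : ℝ) - 1) / 2)⁻¹ *
        ∑ i, ∑ j ∈ Finset.Ioi i, f i x * f j x) ^ (p / 2) ∂μ) /
      ((1 / (N : ℝ)) * ∑ j, ∫ x, f j x ^ p ∂μ))
    (hr : r = 2 * (N : ℝ) / (2 * (N : ℝ) + (p - 2) * (2 * (N : ℝ) - 1))) :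
    ∫ x, (∑ j, f j x) ^ p ∂μ
      ≥ (1 + ((N : ℝ) - 1) * Γ ^ r) ^ (p - 1) * ∑ j, ∫ x, f j x ^ p ∂μ := by
  have hN2 : (2 : ℝ) ≤ N := by exact_mod_cast hN
  rw [← integral_finsetSum _ fun j _ => hLp j] at hne hΓ ⊢
  have hA : Integrable (fun x => ∑ j, f j x ^ p) μ := integrable_finsetSum _ fun j _ => hLp j
  set A := fun x => ∑ j, f j x ^ p with hAdef
  set G := fun x => (((N : ℝ) * ((N : ℝ) - 1) / 2)⁻¹ *
        ∑ i, ∑ j ∈ Finset.Ioi i, f i x * f j x) ^ (p / 2) with hGdef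
  have hG0 : ∀ x, 0 ≤ G x := fun x =>
    Real.rpow_nonneg (pairMean_nonneg N hN fun j => hnn j x) _
  have hGA : ∀ x, G x ≤ (1 / (N : ℝ)) * A x := fun x =>
    pairMean_rpow_le N hN hp1 fun j => hnn j x
  have hGint : Integrable G μ := by
    refine (hA.const_mul (1 / (N : ℝ))).mono' ?_ (ae_of_all _ fun x => ?_)
    · refine Measurable.aestronglyMeasurable ?_
      fun_prop
    · rw [Real.norm_of_nonneg (hG0 x)]
      exact hGA x
  have hSint : Integrable (fun x => (∑ j, f j x) ^ p) μ := by
    refine (hA.const_mul ((N : ℝ) ^ (p - 1))).mono' ?_ (ae_of_all _ fun x => ?_)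
    · refine Measurable.aestronglyMeasurable ?_
      fun_prop
    · rw [Real.norm_of_nonneg (Real.rpow_nonneg (Finset.sum_nonneg fun j _ => hnn j x) _)]
      exact rpow_sum_le_mul_sum_rpow N hp1 fun j => hnn j x
  have hΓmem : Γ ∈ Set.Icc (0 : ℝ) 1 := by
    rw [hΓ]
    refine ⟨div_nonneg (integral_nonneg hG0) (by positivity), div_le_one_of_le₀ ?_ (by positivity)⟩
    rw [← integral_const_mul]
    exact integral_mono hGint (hA.const_mul _) hGA
  obtain ⟨k, hk⟩ := exists_supporting_slope N hN hp1 hp2 hr hΓmem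
  set Φ := (1 + ((N : ℝ) - 1) * Γ ^ r) ^ (p - 1)
  have hpt : ∀ x, Φ * A x + k * (N * G x - Γ * A x) ≤ (∑ j, f j x) ^ p := by
    intro x
    rcases (Finset.sum_nonneg fun j _ => hnn j x : 0 ≤ ∑ j, f j x).eq_or_lt with h0 | hpos
    · have hz : ∀ j, f j x = 0 := fun j =>
        (Finset.sum_eq_zero_iff_of_nonneg fun j _ => hnn j x).1 h0.symm j (Finset.mem_univ j)
      have hp0 : 0 < p := by linarith
      simp [hAdef, hGdef, hz, Real.zero_rpow hp0.ne', Real.zero_rpow (half_pos hp0).ne']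
    · have hmain := mul_sum_rpow_le_rpow_sum N hN hp1 hp2 hr (fun j => hnn j x) hpos
      have hApos : 0 < A x := sum_rpow_pos N hp1 (fun j => hnn j x) hpos
      have hsupp := hk (G x / ((1 / (N : ℝ)) * A x))
        ⟨div_nonneg (hG0 x) (by positivity), div_le_one_of_le₀ (hGA x) (by positivity)⟩
      refine le_trans ?_ hmain
      refine le_trans (le_of_eq ?_) (mul_le_mul_of_nonneg_right hsupp hApos.le)
      change _ = _ * A x
      field_simp
  have hNG : N * ∫ x, G x ∂μ = Γ * ∫ x, A x ∂μ := by
    rw [hΓ]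
    field_simp
  have hlin : Integrable (fun x => k * (N * G x - Γ * A x)) μ :=
    ((hGint.const_mul _).sub (hA.const_mul _)).const_mul _
  calc Φ * ∫ x, A x ∂μ = ∫ x, (Φ * A x + k * (N * G x - Γ * A x)) ∂μ := by
        rw [integral_add (hA.const_mul _) hlin, integral_const_mul, integral_const_mul,
          integral_sub (hGint.const_mul _) (hA.const_mul _), integral_const_mul,
          integral_const_mul, hNG, sub_self, mul_zero, add_zero]
    _ ≤ _ := integral_mono ((hA.const_mul _).add hlin) hSint hpt
end

section
/- For any N ≥ 2, any p > 2, and any nonnegative measurable functions f_1, ..., f_N in L^p of a measure space (not all zero), one has ‖∑_{j=1}^N f_j‖_p^p ≤ [1 + (N-1) Γ̃_p(f_1,...,f_N)^{1/(p-1)}]^{p-1} ∑_{j=1}^N ‖f_j‖_p^p, where Γ̃_p(f_1,...,f_N) := (C(N,2)^{-1} ∑_{i<j} ‖f_i f_j‖_{p/2}^{p/2}) / ((1/N) ∑_{j=1}^N ‖f_j‖_p^p). -/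
open MeasureTheory Finset

/-- A tangent-line bound for `t ↦ t ^ p` evaluated at the geometric mean of `x` and `y`. -/
lemma mul_rpow_half_lower_bound {p x y c : ℝ} (hp : 2 < p) (hx : 0 ≤ x) (hy : 0 ≤ y)
    (hc : 0 < c) :
    x * y + (p - 2) / 2 * (2 * (x * y) - c * (x + y)) ≤ c ^ (2 - p) * (x * y) ^ (p / 2) := by
  set m := √(x * y) with hm
  have hm0 : 0 ≤ m := Real.sqrt_nonneg _
  have hm2 : x * y = m ^ 2 := (Real.sq_sqrt (mul_nonneg hx hy)).symm
  have hxy : 2 * m ≤ x + y := by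
    apply le_of_sq_le_sq _ (by positivity)
    nlinarith [sq_nonneg (x - y)]
  have hpow : (x * y) ^ (p / 2) = m ^ p := by
    rw [hm2, ← Real.rpow_natCast m 2, ← Real.rpow_mul hm0]
    congr 1
    push_cast
    ring
  rw [hpow, hm2]
  have hle : m ^ 2 + (p - 2) / 2 * (2 * m ^ 2 - c * (x + y)) ≤
      (p - 1) * m ^ 2 - (p - 2) * (c * m) := by
    nlinarith [mul_nonneg (mul_nonneg (sub_nonneg.2 hp.le) hc.le) (sub_nonneg.2 hxy)]
  refine hle.trans ?_
  rcases hm0.eq_or_lt with h0 | h0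
  · rw [← h0, Real.zero_rpow (by linarith)]
    simp
  · have hb := one_add_mul_self_le_rpow_one_add (s := m / c - 1)
      (by linarith [div_nonneg hm0 hc.le]) (p := p - 1) (by linarith)
    have h1 : c ^ (2 - p) * m ^ p = c * m * (1 + (m / c - 1)) ^ (p - 1) := by
      rw [add_sub_cancel, Real.div_rpow hm0 hc.le, Real.rpow_sub h0, Real.rpow_sub hc,
        Real.rpow_sub hc, Real.rpow_one, Real.rpow_one, Real.rpow_two]
      have := Real.rpow_pos_of_pos hc p
      field_simp
    rw [h1]
    calc (p - 1) * m ^ 2 - (p - 2) * (c * m)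
        = c * m * (1 + (p - 1) * (m / c - 1)) := by field_simp; ring
      _ ≤ _ := mul_le_mul_of_nonneg_left hb (by positivity)

/-- If `B` is a symmetric positive matrix all of whose rows sum to `D`, then
`(∑ x_i) ^ p ≤ D ^ (p - 2) * ∑ B_ij ^ (2 - p) * (x_i * x_j) ^ (p / 2)`. -/
lemma sum_rpow_le_of_symm_matrix {ι : Type*} [Fintype ι] {p D : ℝ} (hp : 2 < p)
    {x : ι → ℝ} (hx : ∀ i, 0 ≤ x i) {B : ι → ι → ℝ} (hB : ∀ i j, 0 < B i j)
    (hsymm : ∀ i j, B i j = B j i) (hD : 0 < D) (hrow : ∀ i, ∑ j, B i j = D) :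
    (∑ i, x i) ^ p ≤
      D ^ (p - 2) * ∑ i, ∑ j, B i j ^ (2 - p) * (x i * x j) ^ (p / 2) := by
  set T := ∑ i, x i with hT
  have hT0 : 0 ≤ T := sum_nonneg fun i _ => hx i
  rcases hT0.eq_or_lt with h0 | h0
  · rw [← h0, Real.zero_rpow (by linarith)]
    exact mul_nonneg (by positivity) <| sum_nonneg fun i _ => sum_nonneg fun j _ =>
      mul_nonneg (Real.rpow_nonneg (hB i j).le _)
        (Real.rpow_nonneg (mul_nonneg (hx i) (hx j)) _)
  have hc : 0 < T / D := div_pos h0 hD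
  have hterm : ∀ i j, x i * x j +
      (p - 2) / 2 * (2 * (x i * x j) - B i j * (T / D) * (x i + x j)) ≤
      (T / D) ^ (2 - p) * (B i j ^ (2 - p) * (x i * x j) ^ (p / 2)) := fun i j => by
    have h := mul_rpow_half_lower_bound hp (hx i) (hx j) (mul_pos (hB i j) hc)
    rwa [Real.mul_rpow (hB i j).le hc.le, mul_comm (B i j ^ _), mul_assoc (_ ^ _)] at h
  have hxx : ∑ i, x i * ∑ j, x j = T ^ 2 := by
    rw [← sum_mul, ← hT, sq]
  have hBi : ∑ i, ∑ j, B i j * x i = D * T := by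
    rw [hT, mul_sum]
    exact sum_congr rfl fun i _ => by rw [← sum_mul, hrow]
  have hBj : ∑ i, ∑ j, B i j * x j = D * T := by
    rw [sum_comm, ← hBi]
    exact sum_congr rfl fun i _ => sum_congr rfl fun j _ => by rw [hsymm]
  have hsum : ∑ i, ∑ j, (x i * x j +
      (p - 2) / 2 * (2 * (x i * x j) - B i j * (T / D) * (x i + x j))) = T ^ 2 := by
    have : ∀ i j, x i * x j +
        (p - 2) / 2 * (2 * (x i * x j) - B i j * (T / D) * (x i + x j)) =
        (p - 1) * (x i * x j) - (p - 2) / 2 * (T / D) * (B i j * x i) -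
          (p - 2) / 2 * (T / D) * (B i j * x j) := fun i j => by ring
    simp only [this, sum_sub_distrib, ← mul_sum, hxx, hBi, hBj]
    field_simp
    ring
  have hmain : T ^ 2 ≤
      (T / D) ^ (2 - p) * ∑ i, ∑ j, B i j ^ (2 - p) * (x i * x j) ^ (p / 2) := by
    rw [← hsum]
    simp only [mul_sum]
    exact sum_le_sum fun i _ => sum_le_sum fun j _ => hterm i j
  calc T ^ p = T ^ (p - 2) * T ^ 2 := by
        rw [← Real.rpow_natCast T 2, ← Real.rpow_add h0]
        congr 1
        push_cast
        ring
    _ ≤ T ^ (p - 2) *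
        ((T / D) ^ (2 - p) * ∑ i, ∑ j, B i j ^ (2 - p) * (x i * x j) ^ (p / 2)) := by gcongr
    _ = _ := by
        rw [← neg_sub p 2, Real.rpow_neg hc.le, Real.div_rpow hT0 hD.le]
        have := Real.rpow_pos_of_pos h0 (p - 2)
        have := Real.rpow_pos_of_pos hD (p - 2)
        field_simp

lemma sum_sum_eq_diag_add_two_mul {N : ℕ} (M : Fin N → Fin N → ℝ)
    (hM : ∀ i j, M i j = M j i) :
    ∑ i, ∑ j, M i j = ∑ i, M i i + 2 * ∑ i, ∑ j ∈ Ioi i, M i j := by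
  have h := sum_sum_Ioi_add_eq_sum_sum_off_diag M
  have h2 : ∑ i, ∑ j ∈ Ioi i, (M j i + M i j) = 2 * ∑ i, ∑ j ∈ Ioi i, M i j := by
    simp only [mul_sum]
    exact sum_congr rfl fun i _ => sum_congr rfl fun j _ => by rw [hM j i]; ring
  rw [← h2, h, ← sum_add_distrib]
  refine sum_congr rfl fun i _ => ?_
  rw [← sum_add_sum_compl {i}, sum_singleton]
  exact congrArg _ (sum_congr rfl fun j _ => hM i j)

lemma sum_rpow_le_diag_add_off_diag {N : ℕ} (hN : 2 ≤ N) {p g : ℝ} (hp : 2 < p) (hg : 0 < g)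
    {x : Fin N → ℝ} (hx : ∀ i, 0 ≤ x i) :
    (∑ i, x i) ^ p ≤ (1 + ((N : ℝ) - 1) * g) ^ (p - 2) *
      (∑ i, x i ^ p + g ^ (2 - p) * (2 * ∑ i, ∑ j ∈ Ioi i, (x i * x j) ^ (p / 2))) := by
  have hN' : (2 : ℝ) ≤ N := by exact_mod_cast hN
  have hD : 0 < 1 + ((N : ℝ) - 1) * g := by nlinarith
  have h := sum_rpow_le_of_symm_matrix hp hx (B := fun i j => if i = j then 1 else g)
    (fun i j => by split_ifs <;> positivity)
    (fun i j => by simp only [eq_comm]) hD (fun i => by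
      rw [← sum_add_sum_compl {i}, sum_singleton, if_pos rfl,
        sum_congr rfl (g := fun _ => g) (fun j hj => if_neg fun e => by simp [e] at hj)]
      rw [sum_const, card_compl, card_singleton, Fintype.card_fin, nsmul_eq_mul,
        Nat.cast_sub (by omega), Nat.cast_one])
  rw [sum_sum_eq_diag_add_two_mul _ (fun i j => by
    simp only [mul_comm (x i), eq_comm])] at h
  convert h using 3
  · refine sum_congr rfl fun i _ => ?_
    rw [if_pos rfl, Real.one_rpow, one_mul, Real.mul_rpow (hx i) (hx i),
      ← Real.rpow_add_of_nonneg (hx i) (by linarith) (by linarith), add_halves]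
  · rw [mul_left_comm]
    simp only [mul_sum]
    refine sum_congr rfl fun i _ => sum_congr rfl fun j hj => ?_
    rw [if_neg (mem_Ioi.1 hj).ne]

lemma integrable_mul_rpow_half {α : Type*} [MeasurableSpace α] {μ : Measure α} {p : ℝ}
    {f g : α → ℝ} (hf : Measurable f) (hg : Measurable g) (hf0 : ∀ x, 0 ≤ f x)
    (hg0 : ∀ x, 0 ≤ g x) (hfp : Integrable (fun x => f x ^ p) μ)
    (hgp : Integrable (fun x => g x ^ p) μ) :
    Integrable (fun x => (f x * g x) ^ (p / 2)) μ := by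
  refine (hfp.add hgp).mono' ((hf.mul hg).pow_const _).aestronglyMeasurable
    (Filter.Eventually.of_forall fun x => ?_)
  have hsq : ∀ t : ℝ, 0 ≤ t → t ^ p = (t ^ (p / 2)) ^ 2 := fun t ht => by
    rw [← Real.rpow_natCast, ← Real.rpow_mul ht]
    congr 1
    push_cast
    ring
  rw [Real.norm_of_nonneg (Real.rpow_nonneg (mul_nonneg (hf0 x) (hg0 x)) _),
    Real.mul_rpow (hf0 x) (hg0 x), Pi.add_apply, hsq _ (hf0 x), hsq _ (hg0 x)]
  nlinarith [sq_nonneg (f x ^ (p / 2) - g x ^ (p / 2)), sq_nonneg (f x ^ (p / 2)),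
    sq_nonneg (g x ^ (p / 2))]

lemma integral_sum_rpow_le {α : Type*} [MeasurableSpace α] (μ : Measure α)
    {N : ℕ} (hN : 2 ≤ N) {p g : ℝ} (hp : 2 < p) (hg : 0 < g)
    (f : Fin N → α → ℝ) (hm : ∀ j, Measurable (f j)) (hnn : ∀ j x, 0 ≤ f j x)
    (hLp : ∀ j, Integrable (fun x => f j x ^ p) μ) :
    ∫ x, (∑ j, f j x) ^ p ∂μ ≤ (1 + ((N : ℝ) - 1) * g) ^ (p - 2) *
      (∑ j, ∫ x, f j x ^ p ∂μ + g ^ (2 - p) *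
        (2 * ∑ i, ∑ j ∈ Ioi i, ∫ x, (f i x * f j x) ^ (p / 2) ∂μ)) := by
  have hij : ∀ i j, Integrable (fun x => (f i x * f j x) ^ (p / 2)) μ := fun i j =>
    integrable_mul_rpow_half (hm i) (hm j) (hnn i) (hnn j) (hLp i) (hLp j)
  have hdiag : Integrable (fun x => ∑ j, f j x ^ p) μ :=
    integrable_finsetSum _ fun j _ => hLp j
  have hinner : ∀ i, Integrable (fun x => ∑ j ∈ Ioi i, (f i x * f j x) ^ (p / 2)) μ :=
    fun i => integrable_finsetSum _ fun j _ => hij i j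
  have hoff : Integrable (fun x => g ^ (2 - p) *
      (2 * ∑ i, ∑ j ∈ Ioi i, (f i x * f j x) ^ (p / 2))) μ :=
    ((integrable_finsetSum _ fun i _ => hinner i).const_mul _).const_mul _
  refine (integral_mono_of_nonneg
    (Filter.Eventually.of_forall fun x => Real.rpow_nonneg (sum_nonneg fun j _ => hnn j x) _)
    ((hdiag.add hoff).const_mul _) (Filter.Eventually.of_forall fun x =>
      sum_rpow_le_diag_add_off_diag hN hp hg fun j => hnn j x)).trans_eq ?_
  rw [integral_const_mul, integral_add' hdiag hoff, integral_const_mul, integral_const_mul,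
    integral_finsetSum _ fun j _ => hLp j, integral_finsetSum _ fun i _ => hinner i]
  simp only [integral_finsetSum _ fun j _ => hij _ j]

theorem simplified_bound
    {α : Type*} [MeasurableSpace α] (μ : Measure α)
    (N : ℕ) (hN : 2 ≤ N) (p : ℝ) (hp : 2 < p)
    (f : Fin N → α → ℝ) (hm : ∀ j, Measurable (f j))
    (hnn : ∀ j x, 0 ≤ f j x)
    (hLp : ∀ j, Integrable (fun x => f j x ^ p) μ)
    (hne : 0 < ∑ j, ∫ x, f j x ^ p ∂μ)
    (Γt : ℝ)
    (hΓt : Γt = (((N : ℝ) * ((N : ℝ) - 1) / 2)⁻¹ *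
        ∑ i, ∑ j ∈ Finset.Ioi i, ∫ x, (f i x * f j x) ^ (p / 2) ∂μ) /
      ((1 / (N : ℝ)) * ∑ j, ∫ x, f j x ^ p ∂μ)) :
    ∫ x, (∑ j, f j x) ^ p ∂μ
      ≤ (1 + ((N : ℝ) - 1) * Γt ^ (1 / (p - 1))) ^ (p - 1) *
          ∑ j, ∫ x, f j x ^ p ∂μ := by
  have hN' : (2 : ℝ) ≤ N := by exact_mod_cast hN
  have key := fun g hg => integral_sum_rpow_le μ hN hp (g := g) hg f hm hnn hLp
  set a := ∑ j, ∫ x, f j x ^ p ∂μ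
  set e := ∑ i, ∑ j ∈ Finset.Ioi i, ∫ x, (f i x * f j x) ^ (p / 2) ∂μ
  have he : 0 ≤ e := sum_nonneg fun i _ => sum_nonneg fun j _ => integral_nonneg fun x =>
    Real.rpow_nonneg (mul_nonneg (hnn i x) (hnn j x)) _
  have hN1 : 0 < (N : ℝ) - 1 := by linarith
  have hN0 : 0 < (N : ℝ) := by linarith
  have h2e : 2 * e = ((N : ℝ) - 1) * a * Γt := by
    rw [hΓt]
    field_simp
  have hΓ0 : 0 ≤ Γt := by rw [hΓt]; positivity
  rcases hΓ0.eq_or_lt with h0 | h0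
  · rw [h2e, ← h0] at key
    rw [← h0, Real.zero_rpow (one_div_pos.2 (by linarith : 0 < p - 1)).ne']
    have hlim : Filter.Tendsto (fun g : ℝ => (1 + ((N : ℝ) - 1) * g) ^ (p - 2) * a)
        (nhdsWithin 0 (Set.Ioi 0)) (nhds ((1 + ((N : ℝ) - 1) * 0) ^ (p - 2) * a)) := by
      have : ContinuousAt (fun g : ℝ => (1 + ((N : ℝ) - 1) * g) ^ (p - 2) * a) 0 :=
        ((by fun_prop : ContinuousAt (fun g : ℝ => 1 + ((N : ℝ) - 1) * g) 0).rpow_const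
          (Or.inl (by simp))).mul_const a
      exact this.tendsto.mono_left nhdsWithin_le_nhds
    have h := ge_of_tendsto hlim (Filter.eventually_of_mem self_mem_nhdsWithin
      fun g hg => by simpa using key g hg)
    simpa using h
  · have hp1 : 0 < p - 1 := by linarith
    set g := Γt ^ (1 / (p - 1)) with hgdef
    have hg : 0 < g := Real.rpow_pos_of_pos h0 _
    have hΓg : Γt = g ^ (p - 1) := by
      rw [hgdef, ← Real.rpow_mul h0.le, one_div_mul_cancel hp1.ne', Real.rpow_one]
    have hD : 0 < 1 + ((N : ℝ) - 1) * g := by positivity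
    refine (key g hg).trans_eq ?_
    have hgg : g ^ (2 - p) * g ^ (p - 1) = g := by
      rw [← Real.rpow_add hg]
      ring_nf
      exact Real.rpow_one g
    have hDD : (1 + ((N : ℝ) - 1) * g) ^ (p - 1) =
        (1 + ((N : ℝ) - 1) * g) ^ (p - 2) * (1 + ((N : ℝ) - 1) * g) := by
      rw [← Real.rpow_add_one hD.ne']
      ring_nf
    rw [h2e, hΓg, hDD]
    linear_combination (1 + ((N : ℝ) - 1) * g) ^ (p - 2) * ((N : ℝ) - 1) * a * hgg
end

section
/- For all p ≥ 2 and all γ ∈ [0,1], one has ((1+√(1-γ²))/2)^{1/p} + ((1-√(1-γ²))/2)^{1/p})^p ≤ (1 + γ^{2/p})^{p-1}. -/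
open Real Filter Topology Set

/-- The set of positive points where `f` is nonnegative is an initial segment. -/
def NonnegInitially (f : ℝ → ℝ) : Prop :=
  ∀ s t, 0 < s → s < t → 0 ≤ f t → 0 ≤ f s

lemma NonnegInitially.of_eq_mul {f g w : ℝ → ℝ} (hf : NonnegInitially f)
    (hw : ∀ t, 0 < t → 0 < w t) (hg : ∀ t, 0 < t → g t = w t * f t) : NonnegInitially g := by
  intro s t hs hst ht
  rw [hg t (hs.trans hst)] at ht
  rw [hg s hs]
  exact mul_nonneg (hw s hs).le
    (hf s t hs hst (nonneg_of_mul_nonneg_right ht (hw t (hs.trans hst))))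

lemma exists_neg_deriv {f f' : ℝ → ℝ} {a s : ℝ} (hd : ∀ t, 0 < t → HasDerivAt f (f' t) t)
    (h0 : Tendsto f (𝓝[>] 0) (𝓝 a)) (ha : 0 ≤ a) (hs : 0 < s) (hfs : f s < 0) :
    ∃ ξ, 0 < ξ ∧ ξ < s ∧ f' ξ < 0 := by
  obtain ⟨u, hu, hu0, hus⟩ := ((h0.eventually (lt_mem_nhds (hfs.trans_le ha))).and
    (Ioo_mem_nhdsGT hs)).exists
  obtain ⟨ξ, hξ, hξ'⟩ := exists_hasDerivAt_eq_slope f f' hus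
    (fun x hx => (hd x (hu0.trans_le hx.1)).continuousAt.continuousWithinAt)
    (fun x hx => hd x (hu0.trans hx.1))
  refine ⟨ξ, hu0.trans hξ.1, hξ.2, ?_⟩
  rw [hξ']
  exact div_neg_of_neg_of_pos (by linarith) (by linarith)

lemma NonnegInitially.of_deriv {f f' : ℝ → ℝ} {a : ℝ} (hf' : NonnegInitially f')
    (hd : ∀ t, 0 < t → HasDerivAt f (f' t) t) (h0 : Tendsto f (𝓝[>] 0) (𝓝 a)) (ha : 0 ≤ a) :
    NonnegInitially f := by
  intro s t hs hst ht
  by_contra! hfs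
  obtain ⟨ξ, hξ0, hξs, hξ⟩ := exists_neg_deriv hd h0 ha hs hfs
  obtain ⟨η, hη, hη'⟩ := exists_hasDerivAt_eq_slope f f' hst
    (fun x hx => (hd x (hs.trans_le hx.1)).continuousAt.continuousWithinAt)
    (fun x hx => hd x (hs.trans hx.1))
  have : 0 ≤ f' η := by
    rw [hη']
    exact div_nonneg (by linarith) (by linarith)
  exact absurd (hf' ξ η hξ0 (hξs.trans hη.1) this) (not_le.2 hξ)

lemma NonnegInitially.of_deriv_add_mul {f f' : ℝ → ℝ} {c : ℝ}
    (h : NonnegInitially fun t => f' t + c * f t)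
    (hd : ∀ t, HasDerivAt f (f' t) t) (h0 : 0 ≤ f 0) : NonnegInitially f := by
  have hexp : ∀ t, HasDerivAt (fun t => exp (c * t)) (exp (c * t) * c) t := fun t => by
    simpa using ((hasDerivAt_id t).const_mul c).exp
  have hg : ∀ t, HasDerivAt (fun t => exp (c * t) * f t)
      (exp (c * t) * c * f t + exp (c * t) * f' t) t := fun t => (hexp t).mul (hd t)
  have hpat : NonnegInitially fun t => exp (c * t) * f t :=
    (h.of_eq_mul (w := fun t => exp (c * t)) (fun t _ => exp_pos _) (fun t _ => by ring)).of_deriv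
      (fun t _ => hg t) ((hg 0).continuousAt.tendsto.mono_left nhdsWithin_le_nhds) (by simpa)
  refine hpat.of_eq_mul (w := fun t => exp (-(c * t))) (fun t _ => exp_pos _) (fun t _ => ?_)
  rw [← mul_assoc, ← exp_add]
  simp

lemma NonnegInitially.of_second_deriv_sub {f f' f'' : ℝ → ℝ} {c : ℝ}
    (h : NonnegInitially fun t => f'' t - c ^ 2 * f t)
    (hd : ∀ t, HasDerivAt f (f' t) t) (hd' : ∀ t, HasDerivAt f' (f'' t) t)
    (h0 : f 0 = 0) (h0' : 0 ≤ f' 0) : NonnegInitially f := by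
  refine NonnegInitially.of_deriv_add_mul (c := -c) ?_ hd h0.ge
  refine NonnegInitially.of_deriv_add_mul (f' := fun t => f'' t + -c * f' t) (c := c) ?_
    (fun t => (hd' t).add ((hd t).const_mul _)) (by simpa [h0])
  convert h using 2
  ring

lemma hasDerivAt_sinh_mul (a t : ℝ) :
    HasDerivAt (fun t => sinh (a * t)) (a * cosh (a * t)) t := by
  simpa [mul_comm] using ((hasDerivAt_id t).const_mul a).sinh

lemma hasDerivAt_cosh_mul (a t : ℝ) :
    HasDerivAt (fun t => cosh (a * t)) (a * sinh (a * t)) t := by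
  simpa [mul_comm] using ((hasDerivAt_id t).const_mul a).cosh

lemma nonnegInitially_sinh_three {p : ℝ} (hp : 2 < p) : NonnegInitially fun t =>
    -((3 * p - 2) ^ 2 - (p + 2) ^ 2) * sinh ((3 * p - 2) * t) + 8 * (p - 2) * (p + 1) * sinh (p * t)
      + 8 * p * (p ^ 2 - 2) * sinh ((p - 2) * t) := by
  refine NonnegInitially.of_second_deriv_sub (c := p) ?_
    (fun t => (((hasDerivAt_sinh_mul _ t).const_mul _).add
      ((hasDerivAt_sinh_mul _ t).const_mul _)).add ((hasDerivAt_sinh_mul _ t).const_mul _))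
    (fun t => ((((hasDerivAt_cosh_mul _ t).const_mul _).const_mul _).add
      (((hasDerivAt_cosh_mul _ t).const_mul _).const_mul _)).add
      (((hasDerivAt_cosh_mul _ t).const_mul _).const_mul _)) (by simp) ?_
  · intro s t hs hst ht
    exfalso
    have ht0 : 0 < t := hs.trans hst
    have h1 : 0 < sinh ((3 * p - 2) * t) := sinh_pos_iff.2 (mul_pos (by linarith) ht0)
    have h2 : 0 < sinh ((p - 2) * t) := sinh_pos_iff.2 (mul_pos (by linarith) ht0)
    have hA : 0 < 8 * p * (p - 2) * ((4 * p - 2) * (2 * p - 2)) := by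
      apply mul_pos (mul_pos _ _) (mul_pos _ _) <;> linarith
    have hC : 0 < 8 * p * (p ^ 2 - 2) * (4 * p - 4) := by
      apply mul_pos (mul_pos _ _) _ <;> nlinarith
    nlinarith [mul_pos hA h1, mul_pos hC h2]
  · have : 0 ≤ 8 * p * (p - 1) ^ 2 * (p - 2) :=
      mul_nonneg (mul_nonneg (by linarith) (sq_nonneg _)) (by linarith)
    simp only [mul_zero, cosh_zero]
    nlinarith

lemma nonnegInitially_sinh_four {p : ℝ} (hp : 2 < p) : NonnegInitially fun t =>
    -1 * sinh ((3 * p - 2) * t) + (p - 1) ^ 2 * sinh ((p + 2) * t)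
      + (-2 * (p - 2)) * sinh (p * t) + (2 - p ^ 2) * sinh ((p - 2) * t) := by
  refine NonnegInitially.of_second_deriv_sub (c := p + 2) ?_
    (fun t => ((((hasDerivAt_sinh_mul _ t).const_mul _).add
      ((hasDerivAt_sinh_mul _ t).const_mul _)).add ((hasDerivAt_sinh_mul _ t).const_mul _)).add
      ((hasDerivAt_sinh_mul _ t).const_mul _))
    (fun t => (((((hasDerivAt_cosh_mul _ t).const_mul _).const_mul _).add
      (((hasDerivAt_cosh_mul _ t).const_mul _).const_mul _)).add
      (((hasDerivAt_cosh_mul _ t).const_mul _).const_mul _)).add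
      (((hasDerivAt_cosh_mul _ t).const_mul _).const_mul _)) (by simp) ?_
  · convert nonnegInitially_sinh_three hp using 2
    ring
  · simp only [mul_zero, cosh_zero]
    apply le_of_eq
    ring

lemma hasDerivAt_log_cosh_mul (a t : ℝ) :
    HasDerivAt (fun t => log (cosh (a * t))) (a * sinh (a * t) / cosh (a * t)) t :=
  (hasDerivAt_cosh_mul a t).log (cosh_pos _).ne'

lemma sinh_combination_pos {p t : ℝ} (hp : 2 < p) (ht : 0 < t) :
    0 < (p - 1) * sinh ((p + 1) * t) - sinh ((p - 1) * t) := by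
  have h1 : sinh ((p - 1) * t) < sinh ((p + 1) * t) :=
    sinh_lt_sinh.2 (mul_lt_mul_of_pos_right (by linarith) ht)
  have h2 : 0 < sinh ((p + 1) * t) := sinh_pos_iff.2 (mul_pos (by linarith) ht)
  nlinarith

lemma tendsto_sinh_mul_div (a : ℝ) :
    Tendsto (fun t => sinh (a * t) / t) (𝓝[>] 0) (𝓝 a) := by
  have h := (hasDerivAt_iff_tendsto_slope.1 (hasDerivAt_sinh_mul a 0)).mono_left
    (nhdsWithin_mono (0 : ℝ) (fun x (hx : x ∈ Ioi 0) => (mem_Ioi.1 hx).ne'))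
  simpa [slope_fun_def, div_eq_inv_mul] using h

lemma tendsto_log_sinh_ratio {p : ℝ} (hp : 2 < p) : Tendsto (fun t =>
    log (p * sinh ((p - 1) * t)) - log ((p - 1) * sinh ((p + 1) * t) - sinh ((p - 1) * t))
      + 2 / p * log (cosh (p * t))) (𝓝[>] 0) (𝓝 0) := by
  have hne : p * (p - 1) ≠ 0 := (mul_pos (by linarith) (by linarith)).ne'
  have hden : (p - 1) * (p + 1) - (p - 1) = p * (p - 1) := by ring
  have h1 := (((tendsto_sinh_mul_div (p - 1)).const_mul p).log hne).sub
    ((((tendsto_sinh_mul_div (p + 1)).const_mul (p - 1)).sub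
      (tendsto_sinh_mul_div (p - 1))).log (by rwa [hden]))
  have h2 : Tendsto (fun t => 2 / p * log (cosh (p * t))) (𝓝[>] 0) (𝓝 0) := by
    have h := ((hasDerivAt_log_cosh_mul p 0).const_mul (2 / p)).continuousAt.tendsto.mono_left
      (nhdsWithin_le_nhds (s := Ioi 0))
    simpa using h
  have h3 := h1.add h2
  rw [hden, sub_self, zero_add] at h3
  refine h3.congr' ?_
  filter_upwards [self_mem_nhdsWithin] with t (ht : 0 < t)
  have hs : 0 < sinh ((p - 1) * t) := sinh_pos_iff.2 (mul_pos (by linarith) ht)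
  have e1 : p * (sinh ((p - 1) * t) / t) = p * sinh ((p - 1) * t) / t := by ring
  have e2 : (p - 1) * (sinh ((p + 1) * t) / t) - sinh ((p - 1) * t) / t
      = ((p - 1) * sinh ((p + 1) * t) - sinh ((p - 1) * t)) / t := by ring
  rw [e1, e2, log_div (mul_pos (by linarith) hs).ne' ht.ne',
    log_div (sinh_combination_pos hp ht).ne' ht.ne']
  ring

lemma sinh_identity (p t : ℝ) :
    2 * ((p - 1) * cosh ((p - 1) * t) * ((p - 1) * sinh ((p + 1) * t) - sinh ((p - 1) * t))
          * cosh (p * t)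
        - ((p - 1) * ((p + 1) * cosh ((p + 1) * t)) - (p - 1) * cosh ((p - 1) * t))
          * sinh ((p - 1) * t) * cosh (p * t)
        + 2 * sinh (p * t) * sinh ((p - 1) * t)
          * ((p - 1) * sinh ((p + 1) * t) - sinh ((p - 1) * t)))
      = -1 * sinh ((3 * p - 2) * t) + (p - 1) ^ 2 * sinh ((p + 2) * t)
      + (-2 * (p - 2)) * sinh (p * t) + (2 - p ^ 2) * sinh ((p - 2) * t) := by
  have e1 : (p - 1) * t = p * t - t := by ring
  have e2 : (p + 1) * t = p * t + t := by ring
  have e3 : (3 * p - 2) * t = p * t + p * t + p * t - t - t := by ring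
  have e4 : (p + 2) * t = p * t + t + t := by ring
  have e5 : (p - 2) * t = p * t - t - t := by ring
  rw [e1, e2, e3, e4, e5]
  generalize p * t = u
  simp only [sinh_eq, cosh_eq, exp_sub, exp_add, exp_neg]
  have hu := (exp_pos u).ne'
  have ht := (exp_pos t).ne'
  field_simp
  ring

lemma nonnegInitially_log_sinh_ratio {p : ℝ} (hp : 2 < p) : NonnegInitially fun t =>
    log (p * sinh ((p - 1) * t)) - log ((p - 1) * sinh ((p + 1) * t) - sinh ((p - 1) * t))
      + 2 / p * log (cosh (p * t)) := by
  have hs : ∀ t, 0 < t → 0 < sinh ((p - 1) * t) := fun t ht =>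
    sinh_pos_iff.2 (mul_pos (by linarith) ht)
  refine NonnegInitially.of_deriv ?_ (fun t ht => (((((hasDerivAt_sinh_mul (p - 1) t).const_mul
    p).log (mul_pos (by linarith) (hs t ht)).ne').sub
    ((((hasDerivAt_sinh_mul (p + 1) t).const_mul (p - 1)).sub
    (hasDerivAt_sinh_mul (p - 1) t)).log (sinh_combination_pos hp ht).ne')).add
    ((hasDerivAt_log_cosh_mul p t).const_mul (2 / p)))) (tendsto_log_sinh_ratio hp) le_rfl
  refine (nonnegInitially_sinh_four hp).of_eq_mul (w := fun t => (2 * (sinh ((p - 1) * t)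
    * ((p - 1) * sinh ((p + 1) * t) - sinh ((p - 1) * t)) * cosh (p * t)))⁻¹) ?_ ?_
  · intro t ht
    have h1 := hs t ht
    have h2 := sinh_combination_pos hp ht
    have h3 := cosh_pos (p * t)
    positivity
  · intro t ht
    have h1 := (hs t ht).ne'
    have h2 := (sinh_combination_pos hp ht).ne'
    have h3 := (cosh_pos (p * t)).ne'
    have hp0 : p ≠ 0 := by linarith
    rw [← sinh_identity]
    simp only [Pi.sub_apply]
    generalize (p - 1) * sinh ((p + 1) * t) - sinh ((p - 1) * t) = W at *
    field_simp

/-- The logarithmic gap between the two sides, for `γ = 1 / cosh (p * t)`. -/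
noncomputable def logGap (p t : ℝ) : ℝ :=
  (p - 1) * log (1 + exp (-(2 / p * log (cosh (p * t))))) + log (cosh (p * t))
    - p * log (cosh (1 * t)) - (p - 1) * log 2

/-- The derivative of `logGap p`. -/
noncomputable def logGapDeriv (p t : ℝ) : ℝ :=
  (p * sinh ((p - 1) * t) - exp (-(2 / p * log (cosh (p * t))))
      * ((p - 1) * sinh ((p + 1) * t) - sinh ((p - 1) * t)))
    / ((1 + exp (-(2 / p * log (cosh (p * t))))) * cosh (p * t) * cosh t)

lemma hasDerivAt_logGap {p : ℝ} (hp : 2 < p) (t : ℝ) :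
    HasDerivAt (logGap p) (logGapDeriv p t) t := by
  have hG := ((hasDerivAt_log_cosh_mul p t).const_mul (2 / p)).neg.exp
  have h := (((((hG.const_add 1).log (by positivity)).const_mul (p - 1)).add
    (hasDerivAt_log_cosh_mul p t)).sub ((hasDerivAt_log_cosh_mul 1 t).const_mul p)).sub_const
    ((p - 1) * log 2)
  refine h.congr_deriv ?_
  have e1 : (p - 1) * t = p * t - t := by ring
  have e2 : (p + 1) * t = p * t + t := by ring
  simp only [logGapDeriv, Pi.neg_apply, one_mul]
  rw [e1, e2, sinh_sub, sinh_add]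
  have hp0 : p ≠ 0 := by linarith
  have h1 := (cosh_pos (p * t)).ne'
  have h2 := (cosh_pos t).ne'
  have h3 : 1 + exp (-(2 / p * log (cosh (p * t)))) ≠ 0 := by positivity
  generalize exp (-(2 / p * log (cosh (p * t)))) = G at *
  field_simp
  ring

lemma logGapDeriv_nonneg_iff {p t : ℝ} (hp : 2 < p) (ht : 0 < t) : 0 ≤ logGapDeriv p t ↔
    0 ≤ log (p * sinh ((p - 1) * t)) - log ((p - 1) * sinh ((p + 1) * t) - sinh ((p - 1) * t))
      + 2 / p * log (cosh (p * t)) := by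
  have hs : 0 < p * sinh ((p - 1) * t) :=
    mul_pos (by linarith) (sinh_pos_iff.2 (mul_pos (by linarith) ht))
  have hW := sinh_combination_pos hp ht
  have h1 := cosh_pos (p * t)
  have h2 := cosh_pos t
  rw [logGapDeriv, le_div_iff₀ (by positivity), zero_mul, sub_nonneg,
    ← log_le_log_iff (mul_pos (exp_pos _) hW) hs, log_mul (exp_pos _).ne' hW.ne', log_exp]
  constructor <;> intro h <;> linarith

lemma neg_mul_exp_le_logGap {p : ℝ} (hp : 2 < p) (t : ℝ) :
    -(p * exp (-(2 * t))) ≤ logGap p t := by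
  have h1 : 0 ≤ log (1 + exp (-(2 / p * log (cosh (p * t))))) :=
    log_nonneg (by linarith [exp_pos (-(2 / p * log (cosh (p * t))))])
  have h2 : p * t - log 2 ≤ log (cosh (p * t)) := by
    rw [← log_exp (p * t), ← log_div (exp_pos _).ne' two_ne_zero, log_exp]
    refine log_le_log (by positivity) ?_
    rw [cosh_eq]
    linarith [exp_pos (-(p * t))]
  have h3 : log (cosh (1 * t)) ≤ t - log 2 + exp (-(2 * t)) := by
    have : cosh (1 * t) = exp t / 2 * (1 + exp (-(2 * t))) := by
      rw [one_mul, cosh_eq, mul_add, div_mul_eq_mul_div, div_mul_eq_mul_div, ← exp_add]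
      ring_nf
    rw [this, log_mul (by positivity) (by positivity), log_div (exp_pos _).ne' two_ne_zero,
      log_exp]
    linarith [log_le_sub_one_of_pos (show 0 < 1 + exp (-(2 * t)) by positivity)]
  unfold logGap
  nlinarith [mul_le_mul_of_nonneg_left h3 (show 0 ≤ p by linarith),
    mul_nonneg (show 0 ≤ p - 1 by linarith) h1]

lemma logGap_zero (p : ℝ) : logGap p 0 = 0 := by
  simp [logGap, one_add_one_eq_two]

lemma logGap_nonneg {p t : ℝ} (hp : 2 < p) (ht : 0 ≤ t) : 0 ≤ logGap p t := by
  rcases ht.eq_or_lt with rfl | ht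
  · exact (logGap_zero p).ge
  by_contra! hneg
  have hlim := ((hasDerivAt_logGap hp 0).continuousAt.tendsto.mono_left
    (nhdsWithin_le_nhds (s := Ioi 0)))
  obtain ⟨ξ, hξ0, hξt, hξ⟩ := exists_neg_deriv (fun t _ => hasDerivAt_logGap hp t) hlim
    (logGap_zero p).ge ht hneg
  have hanti : AntitoneOn (logGap p) (Ici ξ) := by
    refine antitoneOn_of_deriv_nonpos (convex_Ici ξ)
      (fun x _ => (hasDerivAt_logGap hp x).continuousAt.continuousWithinAt)
      (fun x _ => (hasDerivAt_logGap hp x).differentiableAt.differentiableWithinAt) ?_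
    intro x hx
    rw [interior_Ici, mem_Ioi] at hx
    rw [(hasDerivAt_logGap hp x).deriv]
    by_contra! hpos
    refine absurd ?_ (not_le.2 hξ)
    rw [logGapDeriv_nonneg_iff hp hξ0]
    exact nonnegInitially_log_sinh_ratio hp ξ x hξ0 hx
      ((logGapDeriv_nonneg_iff hp (hξ0.trans hx)).1 hpos.le)
  have hexp : Tendsto (fun x : ℝ => -(p * exp (-(2 * x)))) atTop (𝓝 0) := by
    have := ((tendsto_exp_neg_atTop_nhds_zero.comp
      (tendsto_id.const_mul_atTop (two_pos (α := ℝ)))).const_mul p).neg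
    simpa using this
  obtain ⟨x, hx, htx⟩ := ((hexp.eventually (lt_mem_nhds hneg)).and
    (eventually_ge_atTop t)).exists
  have := hanti (mem_Ici.2 hξt.le) (mem_Ici.2 (hξt.le.trans htx)) htx
  linarith [neg_mul_exp_le_logGap hp x]

lemma rpow_add_rpow_le {p a b : ℝ} (hp : 2 < p) (hb : 0 < b) (hba : b ≤ a) (hab : a + b = 1) :
    (a ^ (1 / p) + b ^ (1 / p)) ^ p ≤ (1 + (4 * a * b) ^ (1 / p)) ^ (p - 1) := by
  have ha : 0 < a := hb.trans_le hba
  have hp0 : p ≠ 0 := by linarith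
  set t : ℝ := (log a - log b) / (2 * p) with ht_def
  have ht : 0 ≤ t := div_nonneg (sub_nonneg.2 (log_le_log hb hba)) (by linarith)
  have hpt : p * t = (log a - log b) / 2 := by
    rw [ht_def]
    field_simp
  have hgap := logGap_nonneg hp ht
  have hcosh : log (cosh (p * t)) = -(log (4 * a * b) / 2) := by
    have h : cosh (p * t) = exp (-((log a + log b) / 2)) / 2 := by
      have e1 : exp (p * t) = a * exp (-((log a + log b) / 2)) := by
        conv_rhs => enter [1]; rw [← exp_log ha]
        rw [← exp_add, hpt]
        ring_nf
      have e2 : exp (-(p * t)) = b * exp (-((log a + log b) / 2)) := by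
        conv_rhs => enter [1]; rw [← exp_log hb]
        rw [← exp_add, hpt]
        ring_nf
      rw [cosh_eq, e1, e2, ← add_mul, hab, one_mul]
    rw [h, log_div (exp_pos _).ne' two_ne_zero, log_exp, log_mul (by positivity) hb.ne',
      log_mul (by positivity) ha.ne', show (4 : ℝ) = 2 ^ 2 by norm_num, log_pow]
    push_cast
    ring
  have hsum : a ^ (1 / p) + b ^ (1 / p)
      = 2 * cosh t * exp ((log a + log b) / (2 * p)) := by
    have e1 : a ^ (1 / p) = exp t * exp ((log a + log b) / (2 * p)) := by
      rw [rpow_def_of_pos ha, ← exp_add, ht_def]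
      ring_nf
    have e2 : b ^ (1 / p) = exp (-t) * exp ((log a + log b) / (2 * p)) := by
      rw [rpow_def_of_pos hb, ← exp_add, ht_def]
      ring_nf
    rw [e1, e2, cosh_eq]
    ring
  have hG : exp (-(2 / p * log (cosh (p * t)))) = (4 * a * b) ^ (1 / p) := by
    rw [rpow_def_of_pos (by positivity), hcosh]
    ring_nf
  have hlogsum : log (a ^ (1 / p) + b ^ (1 / p))
      = log 2 + log (cosh t) + (log a + log b) / (2 * p) := by
    rw [hsum, log_mul (mul_pos two_pos (cosh_pos t)).ne' (exp_pos _).ne',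
      log_mul two_ne_zero (cosh_pos t).ne', log_exp]
  rw [← log_le_log_iff (by positivity) (by positivity), log_rpow (by positivity),
    log_rpow (by positivity), hlogsum]
  rw [logGap, hG, hcosh, one_mul, log_mul (by positivity) hb.ne',
      log_mul (by positivity) ha.ne', show log (4 : ℝ) = 2 * log 2 by
        rw [show (4 : ℝ) = 2 ^ 2 by norm_num, log_pow]; push_cast; ring] at hgap
  have : p * ((log a + log b) / (2 * p)) = (log a + log b) / 2 := by field_simp
  linarith

theorem im_vs_cfil (p : ℝ) (hp : 2 ≤ p) (γ : ℝ) (hγ0 : 0 ≤ γ) (hγ1 : γ ≤ 1) :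
    (((1 + Real.sqrt (1 - γ ^ 2)) / 2) ^ (1 / p)
        + ((1 - Real.sqrt (1 - γ ^ 2)) / 2) ^ (1 / p)) ^ p
      ≤ (1 + γ ^ (2 / p)) ^ (p - 1) := by
  have hp0 : p ≠ 0 := by linarith
  have hsq : Real.sqrt (1 - γ ^ 2) ^ 2 = 1 - γ ^ 2 := sq_sqrt (by nlinarith)
  have hs0 := sqrt_nonneg (1 - γ ^ 2)
  set s := Real.sqrt (1 - γ ^ 2)
  have hs1 : s ≤ 1 := by nlinarith
  have hγ : γ ^ (2 / p) = (4 * ((1 + s) / 2) * ((1 - s) / 2)) ^ (1 / p) := by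
    rw [show 4 * ((1 + s) / 2) * ((1 - s) / 2) = γ ^ (2 : ℝ) by rw [rpow_two]; linarith,
      ← rpow_mul hγ0]
    ring_nf
  rw [hγ]
  rcases hp.eq_or_lt with rfl | hp
  · have ha : 0 ≤ (1 + s) / 2 := by linarith
    have hb : 0 ≤ (1 - s) / 2 := by linarith
    rw [show (2 : ℝ) - 1 = 1 by norm_num, rpow_one, rpow_two, ← sqrt_eq_rpow, ← sqrt_eq_rpow,
      ← sqrt_eq_rpow, sqrt_mul (by positivity), sqrt_mul (by norm_num),
      show (4 : ℝ) = 2 ^ 2 by norm_num, sqrt_sq (by norm_num)]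
    nlinarith [sq_sqrt ha, sq_sqrt hb]
  · rcases hs1.eq_or_lt with h | h
    · simp [h, hp0]
    · exact rpow_add_rpow_le hp (by linarith) (by linarith) (by ring)
end
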